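/- Rapid mixing, dimension-fraction form: Let n ≥ 1, let S be a subspace of (ℂ²)^{⊗n} with orthogonal projector Π_S such that dim S = σ · 2^n for some 0 < σ ≤ 1, and set ρ_S = Π_S / dim S. Let M ∈ M_{2^n} satisfy 0 ≤ M ≤ I and τ(M) = σ^α for some α ≥ 0, and let 0 ≤ γ < 1. Then Tr(M · D_γ^{⊗n}(ρ_S)) ≥ σ^{(√α + γ)²/(1−γ²)}. In particular, when α = 1 this is at least σ^{(1+γ)/(1−γ)}. -/

import Mathlib

open Matrix
open scoped ComplexOrder

noncomputable section

/-- Apply a real function to a Hermitian matrix via the functional calculus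
(junk value `0` on non-Hermitian matrices). -/
def hermFC {ι : Type*} [Fintype ι] [DecidableEq ι] (φ : ℝ → ℝ)
    (f : Matrix ι ι ℂ) : Matrix ι ι ℂ :=
  if hf : f.IsHermitian then
    (hf.eigenvectorUnitary : Matrix ι ι ℂ) *
      Matrix.diagonal (fun i => (φ (hf.eigenvalues i) : ℂ)) *
      (star hf.eigenvectorUnitary : Matrix ι ι ℂ)
  else 0

/-- Real matrix powers of a Hermitian matrix, via the functional calculus on eigenvalues. -/
def mpow {ι : Type*} [Fintype ι] [DecidableEq ι] (f : Matrix ι ι ℂ) (a : ℝ) :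
    Matrix ι ι ℂ :=
  hermFC (fun x => x ^ a) f

/-- The normalized trace `τ(f) = Tr f / d` (real part). -/
def ntrace {ι : Type*} [Fintype ι] [DecidableEq ι] (f : Matrix ι ι ℂ) : ℝ :=
  (f.trace).re / (Fintype.card ι)

/-- Normalized Schatten p-'norm': `‖f‖_p = ((1/d) Tr |f|^p)^(1/p)` with `|f| = √(f† f)`. -/
def snorm {ι : Type*} [Fintype ι] [DecidableEq ι] (p : ℝ) (f : Matrix ι ι ℂ) : ℝ :=
  (ntrace (mpow (fᴴ * f) (p / 2))) ^ (1 / p)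

/-- The entropy `Ent(f) = τ(f ln f) − τ(f) ln τ(f)`. -/
def mEnt {ι : Type*} [Fintype ι] [DecidableEq ι] (f : Matrix ι ι ℂ) : ℝ :=
  ntrace (hermFC (fun x => x * Real.log x) f) - ntrace f * Real.log (ntrace f)

/-- The Dirichlet form `E_L(f,g) = τ(f L(g))`. -/
def dirichlet {ι : Type*} [Fintype ι] [DecidableEq ι]
    (L : Matrix ι ι ℂ → Matrix ι ι ℂ) (f g : Matrix ι ι ℂ) : ℝ :=
  ntrace (f * L g)

/-- Complete positivity: every matrix extension `id_m ⊗ T` maps PSD matrices to PSD matrices. -/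
def IsCompletelyPositive {ι : Type*} [Fintype ι] [DecidableEq ι]
    (T : Matrix ι ι ℂ → Matrix ι ι ℂ) : Prop :=
  ∀ (m : ℕ) (M : Matrix (Fin m × ι) (Fin m × ι) ℂ), M.PosSemidef →
    (Matrix.of fun p q : Fin m × ι =>
      T (Matrix.of fun i j : ι => M (p.1, i) (q.1, j)) p.2 q.2).PosSemidef

/-- A quantum channel: a linear, completely positive, trace-preserving map. -/
def IsQChannel {ι : Type*} [Fintype ι] [DecidableEq ι]
    (T : Matrix ι ι ℂ → Matrix ι ι ℂ) : Prop :=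
  IsLinearMap ℂ T ∧ IsCompletelyPositive T ∧ ∀ f, (T f).trace = f.trace

/-- Reversibility (detailed balance w.r.t. the trace): `τ(f T(g)) = τ(T(f) g)`. -/
def IsReversible {ι : Type*} [Fintype ι] [DecidableEq ι]
    (T : Matrix ι ι ℂ → Matrix ι ι ℂ) : Prop :=
  ∀ f g : Matrix ι ι ℂ, (f * T g).trace = (T f * g).trace

/-- Primitivity: iterates of `T` converge on every density matrix to a fixed
full-rank state independent of the input. -/
def IsPrimitive {ι : Type*} [Fintype ι] [DecidableEq ι]
    (T : Matrix ι ι ℂ → Matrix ι ι ℂ) : Prop :=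
  ∃ σ : Matrix ι ι ℂ, σ.PosDef ∧ σ.trace = 1 ∧
    ∀ ρ : Matrix ι ι ℂ, ρ.PosSemidef → ρ.trace = 1 →
      Filter.Tendsto (fun k => T^[k] ρ) Filter.atTop (nhds σ)

/-- The depolarizing channel with parameter `γ` applied to the `k`-th qubit of `n` qubits:
`D_γ(f) = γ f + (1−γ) (tr_k f) ⊗_k (I/2)`. -/
def depolAt {n : ℕ} (γ : ℝ) (k : Fin n)
    (f : Matrix (Fin n → Fin 2) (Fin n → Fin 2) ℂ) :
    Matrix (Fin n → Fin 2) (Fin n → Fin 2) ℂ :=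
  Matrix.of fun x y =>
    (γ : ℂ) * f x y +
      ((1 - γ : ℝ) : ℂ) *
        (if x k = y k then
          (1 / 2) * ∑ b : Fin 2, f (Function.update x k b) (Function.update y k b)
        else 0)

/-- The tensor power `D_γ^{⊗n}` of the qubit depolarizing channel, acting on `n` qubits. -/
def depolChannel {n : ℕ} (γ : ℝ)
    (f : Matrix (Fin n → Fin 2) (Fin n → Fin 2) ℂ) :
    Matrix (Fin n → Fin 2) (Fin n → Fin 2) ℂ :=
  (List.finRange n).foldl (fun g k => depolAt γ k g) f

/-- The semigroup element `e^{−tL}` applied to `f`, defined by its power series. -/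
def opExp {ι : Type*} [Fintype ι] [DecidableEq ι]
    (L : Matrix ι ι ℂ → Matrix ι ι ℂ) (t : ℝ) (f : Matrix ι ι ℂ) : Matrix ι ι ℂ :=
  ∑' k : ℕ, (((-t) ^ k / (Nat.factorial k) : ℝ) : ℂ) • L^[k] f

/-- The classical noise operator `T_γ` on functions on the boolean cube:
each bit is flipped independently with probability `(1−γ)/2`. -/
def noiseOp {n : ℕ} (γ : ℝ) (f : (Fin n → Fin 2) → ℝ) : (Fin n → Fin 2) → ℝ :=
  fun x => ∑ y : Fin n → Fin 2,
    (∏ i : Fin n, if y i = x i then (1 + γ) / 2 else (1 - γ) / 2) * f y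

/-- The normalized `ℓ_p` 'norm' `‖f‖_p = (2^{-n} Σ_x |f(x)|^p)^{1/p}` on the boolean cube. -/
def lpnorm {n : ℕ} (p : ℝ) (f : (Fin n → Fin 2) → ℝ) : ℝ :=
  ((∑ x : Fin n → Fin 2, |f x| ^ p) / 2 ^ n) ^ (1 / p)

end

/-- The matrix `U diag(x) Uᴴ` with real `x`. -/
noncomputable def specMat {m : Type*} [Fintype m] [DecidableEq m] (U : Matrix m m ℂ) (x : m → ℝ) :
    Matrix m m ℂ :=
  U * diagonal (fun i => (x i : ℂ)) * Uᴴ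

section Spectral

variable {m : Type*} [Fintype m] [DecidableEq m]

lemma mul_conjTranspose_diag {ι : Type*} [Fintype ι] (A : Matrix ι ι ℂ) (i : ι) :
    ((A * Aᴴ) i i).re = ∑ k, Complex.normSq (A i k) := by
  simp [Matrix.mul_apply, Complex.mul_conj]

lemma row_normSq_mul_unitary {Q : Matrix m m ℂ} (hQ : Q * Qᴴ = 1) (A : Matrix m m ℂ) (i : m) :
    ∑ j, Complex.normSq ((A * Q) i j) = ∑ k, Complex.normSq (A i k) := by
  rw [← mul_conjTranspose_diag, ← mul_conjTranspose_diag, conjTranspose_mul, Matrix.mul_assoc,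
    ← Matrix.mul_assoc Q, hQ, Matrix.one_mul]

lemma row_normSq_unitary {Q : Matrix m m ℂ} (hQ : Q * Qᴴ = 1) (i : m) :
    ∑ j, Complex.normSq (Q i j) = 1 := by
  rw [← mul_conjTranspose_diag, hQ]; simp

lemma col_normSq_unitary {Q : Matrix m m ℂ} (hQ : Qᴴ * Q = 1) (j : m) :
    ∑ i, Complex.normSq (Q i j) = 1 := by
  have h := row_normSq_unitary (Q := Qᴴ) (by simpa using hQ) j
  simpa [Complex.normSq_conj] using h

lemma trace_specMat_mul (U V A : Matrix m m ℂ) (x y : m → ℝ) :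
    (specMat U x * A * specMat V y * Aᴴ).trace.re =
      ∑ i, ∑ j, x i * y j * Complex.normSq ((Uᴴ * A * V) i j) := by
  have h : (specMat U x * A * specMat V y * Aᴴ).trace =
      (diagonal (fun i => (x i : ℂ)) * ((Uᴴ * A * V) * diagonal (fun i => (y i : ℂ)) *
        (Uᴴ * A * V)ᴴ)).trace := by
    unfold specMat
    simp only [conjTranspose_mul, conjTranspose_conjTranspose, Matrix.mul_assoc]
    rw [Matrix.trace_mul_comm U]
    simp only [Matrix.mul_assoc]
  rw [h, Matrix.trace]
  simp only [diag_apply, diagonal_mul, Complex.re_sum, Complex.re_ofReal_mul]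
  refine Finset.sum_congr rfl fun i _ => ?_
  rw [Matrix.mul_apply, Complex.re_sum, Finset.mul_sum]
  refine Finset.sum_congr rfl fun j _ => ?_
  rw [mul_diagonal, conjTranspose_apply, mul_assoc]
  have : (Uᴴ * A * V) i j * ((y j : ℂ) * star ((Uᴴ * A * V) i j)) =
      ((y j * Complex.normSq ((Uᴴ * A * V) i j) : ℝ) : ℂ) := by
    rw [Complex.ofReal_mul, ← Complex.mul_conj]; simp; ring
  rw [this, Complex.ofReal_re]; ring

lemma specMat_mul {U : Matrix m m ℂ} (hU : Uᴴ * U = 1) (x y : m → ℝ) :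
    specMat U x * specMat U y = specMat U (fun i => x i * y i) := by
  have : U * diagonal (fun i => (x i : ℂ)) * Uᴴ * (U * diagonal (fun i => (y i : ℂ)) * Uᴴ) =
      U * (diagonal (fun i => (x i : ℂ)) * ((Uᴴ * U) * diagonal (fun i => (y i : ℂ)))) * Uᴴ := by
    simp only [Matrix.mul_assoc]
  unfold specMat
  rw [this, hU, Matrix.one_mul, diagonal_mul_diagonal]
  simp

lemma specMat_const {U : Matrix m m ℂ} (hU : U * Uᴴ = 1) (c : ℝ) :
    specMat U (fun _ => c) = (c : ℂ) • 1 := by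
  have : (diagonal fun _ : m => (c : ℂ)) = (c : ℂ) • 1 := by
    ext i j; by_cases h : i = j <;> simp [h]
  simp [specMat, this, hU]

lemma specMat_add (U : Matrix m m ℂ) (x y : m → ℝ) :
    specMat U (fun i => x i + y i) = specMat U x + specMat U y := by
  simp [specMat, ← diagonal_add, Matrix.mul_add, Matrix.add_mul]

lemma trace_specMat {U : Matrix m m ℂ} (hU : Uᴴ * U = 1) (x : m → ℝ) :
    (specMat U x).trace.re = ∑ i, x i := by
  rw [specMat, Matrix.trace_mul_comm, ← Matrix.mul_assoc, hU, Matrix.one_mul, trace_diagonal]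
  simp

lemma specMat_isHermitian (U : Matrix m m ℂ) (x : m → ℝ) : (specMat U x).IsHermitian := by
  unfold specMat IsHermitian
  simp only [conjTranspose_mul, conjTranspose_conjTranspose, Matrix.mul_assoc,
    diagonal_conjTranspose]
  congr 3
  ext i; simp

lemma exists_specMat {f : Matrix m m ℂ} (hf : f.IsHermitian) :
    ∃ (U : Matrix m m ℂ) (x : m → ℝ), U * Uᴴ = 1 ∧ Uᴴ * U = 1 ∧ f = specMat U x := by
  refine ⟨hf.eigenvectorUnitary, hf.eigenvalues, ?_, ?_, ?_⟩
  · exact (Matrix.mem_unitaryGroup_iff.1 hf.eigenvectorUnitary.2)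
  · exact (Matrix.mem_unitaryGroup_iff'.1 hf.eigenvectorUnitary.2)
  · conv_lhs => rw [hf.spectral_theorem]
    simp [specMat, Unitary.conjStarAlgAut_apply, star_eq_conjTranspose, Function.comp_def]

lemma specMat_conj_apply (U W : Matrix m m ℂ) (x : m → ℝ) (k : m) :
    ((Wᴴ * specMat U x * W) k k).re = ∑ i, x i * Complex.normSq ((Uᴴ * W) i k) := by
  have : Wᴴ * specMat U x * W = (Uᴴ * W)ᴴ * (diagonal (fun i => (x i : ℂ)) * (Uᴴ * W)) := by
    simp [specMat, Matrix.mul_assoc]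
  rw [this, Matrix.mul_apply, Complex.re_sum]
  refine Finset.sum_congr rfl fun i _ => ?_
  rw [diagonal_mul, conjTranspose_apply]
  have : star ((Uᴴ * W) i k) * ((x i : ℂ) * (Uᴴ * W) i k) =
      ((x i * Complex.normSq ((Uᴴ * W) i k) : ℝ) : ℂ) := by
    rw [Complex.ofReal_mul, ← Complex.mul_conj]; simp; ring
  rw [this, Complex.ofReal_re]

lemma specMat_coeff {U : Matrix m m ℂ} (hU : Uᴴ * U = 1) (x : m → ℝ) :
    Uᴴ * specMat U x * U = diagonal (fun i => (x i : ℂ)) := by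
  simp only [specMat, Matrix.mul_assoc]
  rw [hU, ← Matrix.mul_assoc, hU]; simp

lemma nonneg_of_specMat_posSemidef {U : Matrix m m ℂ} (hU : Uᴴ * U = 1) {x : m → ℝ}
    (h : (specMat U x).PosSemidef) (i : m) : 0 ≤ x i := by
  have h2 := h.conjTranspose_mul_mul_same U
  rw [specMat_coeff hU] at h2
  have := h2.diag_nonneg (i := i)
  simpa using this

/-- Functional calculus does not depend on the diagonalisation. -/
lemma specMat_comp_eq {U V : Matrix m m ℂ} (hU : U * Uᴴ = 1) (hU' : Uᴴ * U = 1)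
    (hV : V * Vᴴ = 1) (hV' : Vᴴ * V = 1) {x y : m → ℝ} (h : specMat U x = specMat V y)
    (φ : ℝ → ℝ) : specMat U (fun i => φ (x i)) = specMat V (fun i => φ (y i)) := by
  have key : ∀ i j, (x i : ℂ) * (Uᴴ * V) i j = (Uᴴ * V) i j * (y j : ℂ) := by
    intro i j
    have : diagonal (fun i => (x i : ℂ)) * (Uᴴ * V) = (Uᴴ * V) * diagonal (fun i => (y i : ℂ)) := by
      have e1 : Uᴴ * specMat U x * V = diagonal (fun i => (x i : ℂ)) * (Uᴴ * V) := by
        simp only [specMat, ← Matrix.mul_assoc]; rw [hU', Matrix.one_mul]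
      have e2 : Uᴴ * specMat V y * V = (Uᴴ * V) * diagonal (fun i => (y i : ℂ)) := by
        simp only [specMat, Matrix.mul_assoc]; rw [hV', Matrix.mul_one]
      rw [← e1, h, e2]
    have := congrFun (congrFun this i) j
    rwa [diagonal_mul, mul_diagonal] at this
  have key2 : diagonal (fun i => (φ (x i) : ℂ)) * (Uᴴ * V) =
      (Uᴴ * V) * diagonal (fun i => (φ (y i) : ℂ)) := by
    ext i j
    rw [diagonal_mul, mul_diagonal]
    by_cases h0 : (Uᴴ * V) i j = 0
    · simp [h0]
    · have : (x i : ℂ) = y j := by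
        have := key i j
        rw [mul_comm] at this
        exact mul_left_cancel₀ h0 this
      have : x i = y j := by exact_mod_cast this
      simp [this, mul_comm]
  calc specMat U (fun i => φ (x i)) = U * (diagonal (fun i => (φ (x i) : ℂ)) * (Uᴴ * V)) * Vᴴ := by
        simp only [specMat, Matrix.mul_assoc]; rw [hV, Matrix.mul_one]
    _ = _ := by
        rw [key2]
        simp only [specMat, ← Matrix.mul_assoc]; rw [hU, Matrix.one_mul]

lemma sum_comp_eq_of_specMat_eq {U V : Matrix m m ℂ} (hU : U * Uᴴ = 1) (hU' : Uᴴ * U = 1)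
    (hV : V * Vᴴ = 1) (hV' : Vᴴ * V = 1) {x y : m → ℝ} (h : specMat U x = specMat V y)
    (φ : ℝ → ℝ) : ∑ i, φ (x i) = ∑ i, φ (y i) := by
  have := congrArg (fun M => (Matrix.trace M).re) (specMat_comp_eq hU hU' hV hV' h φ)
  simpa [trace_specMat hU', trace_specMat hV'] using this

end Spectral

section Scalar

lemma exp_neg_le_quadratic {u : ℝ} (hu : 0 ≤ u) : Real.exp (-u) ≤ 1 - u + u ^ 2 / 2 := by
  have h := Real.quadratic_le_exp_of_nonneg hu
  have hp : 0 < Real.exp u := Real.exp_pos u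
  rw [Real.exp_neg, inv_le_comm₀ hp (by nlinarith [sq_nonneg (u - 1)])]
  refine le_trans ?_ h
  rw [inv_le_iff_one_le_mul₀ (by nlinarith [sq_nonneg (u - 1)])]
  nlinarith [sq_nonneg u, sq_nonneg (u^2)]

lemma log_two_div_le {a b : ℝ} (ha : 0 < a) (hb : a ≤ b) :
    Real.log (2 * b ^ 2 / (a ^ 2 + b ^ 2)) ≤ 1 - a / b := by
  have hb0 : 0 < b := ha.trans_le hb
  have hu : 0 ≤ 1 - a / b := by
    rw [sub_nonneg, div_le_one hb0]; exact hb
  have h := exp_neg_le_quadratic hu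
  rw [Real.log_le_iff_le_exp (by positivity)]
  have h2 : (Real.exp (1 - a / b))⁻¹ ≤ (2 * b ^ 2 / (a ^ 2 + b ^ 2))⁻¹ := by
    rw [← Real.exp_neg]
    refine h.trans (le_of_eq ?_)
    field_simp
    ring
  exact (inv_le_inv₀ (Real.exp_pos _) (by positivity)).1 h2

/-- The two-point logarithmic Sobolev inequality. -/
lemma two_point_log_sobolev {a b : ℝ} (ha : 0 < a) (hb : 0 < b) :
    a ^ 2 * Real.log (a ^ 2) + b ^ 2 * Real.log (b ^ 2) ≤
      (a ^ 2 + b ^ 2) * Real.log ((a ^ 2 + b ^ 2) / 2) + (a - b) ^ 2 := by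
  wlog hab : a ≤ b generalizing a b with H
  · have := H hb ha (le_of_not_ge hab)
    rw [add_comm (a ^ 2) (b ^ 2)]
    nlinarith [this]
  let G : ℝ → ℝ := fun t => (a ^ 2 + t ^ 2) * Real.log ((a ^ 2 + t ^ 2) / 2) + (a - t) ^ 2 -
    a ^ 2 * Real.log (a ^ 2) - t ^ 2 * Real.log (t ^ 2)
  have hder : ∀ t, 0 < t → HasDerivAt G
      (2 * t * Real.log ((a ^ 2 + t ^ 2) / 2) - 2 * (a - t) - 2 * t * Real.log (t ^ 2)) t := by
    intro t ht
    have h1 : HasDerivAt (fun t : ℝ => a ^ 2 + t ^ 2) (2 * t) t := by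
      simpa using (hasDerivAt_pow 2 t).const_add (a ^ 2)
    have h2 := (h1.div_const 2).log (by positivity)
    have h3 := h1.mul h2
    have h4 : HasDerivAt (fun t : ℝ => (a - t) ^ 2) (-2 * (a - t)) t := by
      exact (((hasDerivAt_id t).const_sub a).pow 2).congr_deriv (by simp)
    have h5 : HasDerivAt (fun t : ℝ => t ^ 2) (2 * t) t := by simpa using hasDerivAt_pow 2 t
    have h6 := h5.mul (h5.log (by positivity))
    refine (((h3.add h4).sub_const (a ^ 2 * Real.log (a ^ 2))).sub h6).congr_deriv ?_
    field_simp
    ring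
  have hmono : MonotoneOn G (Set.Ici a) := by
    apply monotoneOn_of_deriv_nonneg (convex_Ici a)
    · intro t ht
      exact (hder t (ha.trans_le ht)).continuousAt.continuousWithinAt
    · intro t ht
      rw [interior_Ici] at ht
      exact (hder t (ha.trans ht)).differentiableAt.differentiableWithinAt
    · intro t ht
      rw [interior_Ici] at ht
      have ht0 : 0 < t := ha.trans ht
      rw [(hder t ht0).deriv]
      have h := log_two_div_le ha (le_of_lt ht)
      have e : Real.log (2 * t ^ 2 / (a ^ 2 + t ^ 2)) =
          Real.log (t ^ 2) - Real.log ((a ^ 2 + t ^ 2) / 2) := by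
        rw [← Real.log_div (by positivity) (by positivity)]
        congr 1; field_simp
      rw [e] at h
      have h7 : t * (Real.log (t ^ 2) - Real.log ((a ^ 2 + t ^ 2) / 2)) ≤ t - a := by
        have := mul_le_mul_of_nonneg_left h ht0.le
        have e2 : t * (1 - a / t) = t - a := by field_simp
        rwa [e2] at this
      nlinarith
  have h := hmono (Set.mem_Ici.2 le_rfl) (Set.mem_Ici.2 hab) hab
  have h0 : G a = 0 := by
    simp only [G]
    have : (a ^ 2 + a ^ 2) / 2 = a ^ 2 := by ring
    rw [this]; ring
  rw [h0] at h
  simp only [G] at h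
  linarith

/-- Monotonicity of `c ↦ a² log (a² + c) + b² log (b² + c) - (a²+b²) log ((a²+b²)/2 + c)`
combined with the two-point inequality. -/
lemma two_point_shift {a b c : ℝ} (ha : 0 < a) (hb : 0 < b) (hc : 0 ≤ c) :
    a ^ 2 * Real.log (a ^ 2 + c) + b ^ 2 * Real.log (b ^ 2 + c) ≤
      (a ^ 2 + b ^ 2) * Real.log ((a ^ 2 + b ^ 2) / 2 + c) + (a - b) ^ 2 := by
  let G : ℝ → ℝ := fun t => a ^ 2 * Real.log (a ^ 2 + t) + b ^ 2 * Real.log (b ^ 2 + t) -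
    (a ^ 2 + b ^ 2) * Real.log ((a ^ 2 + b ^ 2) / 2 + t)
  have hder : ∀ t, 0 ≤ t → HasDerivAt G
      (a ^ 2 * (1 / (a ^ 2 + t)) + b ^ 2 * (1 / (b ^ 2 + t)) -
        (a ^ 2 + b ^ 2) * (1 / ((a ^ 2 + b ^ 2) / 2 + t))) t := by
    intro t ht
    have h (x : ℝ) (hx : 0 < x) : HasDerivAt (fun t => Real.log (x + t)) (1 / (x + t)) t := by
      simpa using ((hasDerivAt_id t).const_add x).log (by simp; positivity)
    exact (((h _ (by positivity)).const_mul _).add ((h _ (by positivity)).const_mul _)).sub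
      ((h _ (by positivity)).const_mul _)
  have hanti : AntitoneOn G (Set.Ici 0) := by
    apply antitoneOn_of_deriv_nonpos (convex_Ici 0)
    · intro t ht
      exact (hder t ht).continuousAt.continuousWithinAt
    · intro t ht
      rw [interior_Ici] at ht
      exact (hder t (le_of_lt ht)).differentiableAt.differentiableWithinAt
    · intro t ht
      rw [interior_Ici] at ht
      have ht0 : 0 < t := ht
      rw [(hder t (le_of_lt ht)).deriv]
      have e : a ^ 2 * (1 / (a ^ 2 + t)) + b ^ 2 * (1 / (b ^ 2 + t)) -
        (a ^ 2 + b ^ 2) * (1 / ((a ^ 2 + b ^ 2) / 2 + t)) =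
        - (t * (a ^ 2 - b ^ 2) ^ 2) / ((a ^ 2 + t) * (b ^ 2 + t) * (a ^ 2 + b ^ 2 + 2 * t)) := by
        have : (a ^ 2 + b ^ 2) / 2 + t = (a ^ 2 + b ^ 2 + 2 * t) / 2 := by ring
        rw [this]
        field_simp
        ring
      rw [e]
      exact div_nonpos_of_nonpos_of_nonneg (by nlinarith [mul_nonneg ht0.le (sq_nonneg (a^2-b^2))])
        (by positivity)
  have h := hanti (Set.mem_Ici.2 le_rfl) (Set.mem_Ici.2 hc) hc
  simp only [G, add_zero] at h
  have := two_point_log_sobolev ha hb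
  linarith

/-- Gibbs' variational inequality. -/
lemma gibbs_inequality {ι : Type*} [Fintype ι] (z r : ι → ℝ) (hz : ∀ i, 0 ≤ z i)
    (hr : ∀ i, 0 < r i) :
    ∑ i, z i * Real.log (r i) ≤ ∑ i, z i * Real.log (z i) +
      (∑ i, z i) * Real.log (∑ i, r i) - (∑ i, z i) * Real.log (∑ i, z i) := by
  set S := ∑ i, z i with hS
  set R := ∑ i, r i with hR
  rcases (Finset.sum_nonneg fun i _ => hz i : 0 ≤ ∑ i, z i).eq_or_lt' with h0 | hpos
  · have hzi : ∀ i, z i = 0 := fun i =>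
      (Finset.sum_eq_zero_iff_of_nonneg fun i _ => hz i).1 h0 i (Finset.mem_univ i)
    have : S = 0 := h0
    simp [this, hzi]
  · have hSpos : 0 < S := hpos
    have hne : Nonempty ι := by
      by_contra hn
      rw [not_nonempty_iff] at hn
      simp [hS] at hSpos
    have hRpos : 0 < R := Finset.sum_pos (fun i _ => hr i) Finset.univ_nonempty
    have key : ∀ i, z i * Real.log (r i) ≤ z i * Real.log (z i) + z i * Real.log R
        - z i * Real.log S + (r i * (S / R) - z i) := by
      intro i
      rcases (hz i).eq_or_lt' with h | h
      · rw [h]; simp; have := hr i; positivity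
      · have := Real.log_le_sub_one_of_pos (x := r i * S / (R * z i)) (by have := hr i; positivity)
        rw [Real.log_div (by have := hr i; positivity) (by positivity),
          Real.log_mul (hr i).ne' hSpos.ne', Real.log_mul hRpos.ne' h.ne'] at this
        have h2 := mul_le_mul_of_nonneg_left this h.le
        have e : z i * (r i * S / (R * z i) - 1) = r i * (S / R) - z i := by
          field_simp
        rw [e] at h2
        linarith
    have hsum := Finset.sum_le_sum fun i (_ : i ∈ Finset.univ) => key i
    simp only [Finset.sum_add_distrib, Finset.sum_sub_distrib, ← Finset.sum_mul] at hsum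
    rw [← hS, ← hR] at hsum
    have : R * (S / R) - S = 0 := by field_simp; ring
    linarith

end Scalar

section LogJensen

variable {m : Type*} [Fintype m] [DecidableEq m]

lemma col_normSq_unitary_mul {Q : Matrix m m ℂ} (hQ : Qᴴ * Q = 1) (A : Matrix m m ℂ) (j : m) :
    ∑ i, Complex.normSq ((Q * A) i j) = ∑ i, Complex.normSq (A i j) := by
  have h := row_normSq_mul_unitary (Q := Qᴴ) (by simpa using hQ) Aᴴ j
  rw [← conjTranspose_mul] at h
  simpa [conjTranspose_apply, Complex.normSq_conj] using h

lemma sum_re_mul_star {ι : Type*} [Fintype ι] (A B : Matrix ι ι ℂ) :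
    ∑ i, ∑ j, (A i j * (starRingEnd ℂ) (B i j)).re = (A * Bᴴ).trace.re := by
  simp [Matrix.trace, Matrix.mul_apply]

/-- Weighted row and column masses of a matrix `S diag(y) T` with `S`, `T` unitary. -/
lemma weighted_sum_normSq {S T : Matrix m m ℂ} (hS' : Sᴴ * S = 1) (hT : T * Tᴴ = 1)
    (a y : m → ℝ) :
    ∑ i, ∑ j, (a i + a j) / 2 *
        Complex.normSq ((S * diagonal (fun k => (y k : ℂ)) * T) i j) =
      ∑ k, y k ^ 2 * ((∑ i, a i * Complex.normSq (S i k) +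
        ∑ j, a j * Complex.normSq (T k j)) / 2) := by
  have h1 : ∀ i, ∑ j, Complex.normSq ((S * diagonal (fun k => (y k : ℂ)) * T) i j) =
      ∑ k, y k ^ 2 * Complex.normSq (S i k) := by
    intro i
    rw [row_normSq_mul_unitary hT]
    refine Finset.sum_congr rfl fun k _ => ?_
    rw [mul_diagonal, Complex.normSq_mul, Complex.normSq_ofReal]; ring
  have h2 : ∀ j, ∑ i, Complex.normSq ((S * diagonal (fun k => (y k : ℂ)) * T) i j) =
      ∑ k, y k ^ 2 * Complex.normSq (T k j) := by
    intro j
    rw [Matrix.mul_assoc, col_normSq_unitary_mul hS']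
    refine Finset.sum_congr rfl fun k _ => ?_
    rw [diagonal_mul, Complex.normSq_mul, Complex.normSq_ofReal]; ring
  set Y := S * diagonal (fun k => (y k : ℂ)) * T
  have e1 : ∑ i, ∑ j, (a i + a j) / 2 * Complex.normSq (Y i j) =
      (∑ i, a i * ∑ j, Complex.normSq (Y i j) + ∑ j, a j * ∑ i, Complex.normSq (Y i j)) / 2 := by
    simp only [Finset.mul_sum]
    rw [Finset.sum_comm (f := fun j i => a j * Complex.normSq (Y i j)), ← Finset.sum_add_distrib,
      Finset.sum_div]
    refine Finset.sum_congr rfl fun i _ => ?_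
    rw [← Finset.sum_add_distrib, Finset.sum_div]
    refine Finset.sum_congr rfl fun j _ => ?_
    ring
  rw [e1]
  simp only [h1, h2]
  have e2 : ∀ g : m → m → ℝ, ∑ i, a i * ∑ k, y k ^ 2 * g i k = ∑ k, y k ^ 2 * ∑ i, a i * g i k := by
    intro g
    simp only [Finset.mul_sum]
    rw [Finset.sum_comm]
    refine Finset.sum_congr rfl fun k _ => Finset.sum_congr rfl fun i _ => ?_
    ring
  rw [e2 fun i k => Complex.normSq (S i k), e2 fun j k => Complex.normSq (T k j),
    ← Finset.sum_add_distrib, Finset.sum_div]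
  refine Finset.sum_congr rfl fun k _ => ?_
  ring

lemma sum_normSq_unitary_diag {S T : Matrix m m ℂ} (hS' : Sᴴ * S = 1) (hT : T * Tᴴ = 1)
    (z : m → ℝ) :
    ∑ i, ∑ j, Complex.normSq ((S * diagonal (fun k => (z k : ℂ)) * T) i j) = ∑ k, z k ^ 2 := by
  have h := weighted_sum_normSq hS' hT (fun _ => 1) z
  simp only [one_mul, row_normSq_unitary hT, col_normSq_unitary hS'] at h
  simpa using h

lemma sum_sq_div_le {S T : Matrix m m ℂ} (hS' : Sᴴ * S = 1)
    (hT : T * Tᴴ = 1) (a z : m → ℝ) (ha : ∀ i, 0 < a i) (r : m → ℝ)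
    (hr : ∀ k, r k = (∑ i, a i * Complex.normSq (S i k) + ∑ j, a j * Complex.normSq (T k j)) / 2)
    (hr0 : ∀ k, 0 < r k) :
    ∑ k, z k ^ 2 / r k ≤
      ∑ i, ∑ j, Complex.normSq ((S * diagonal (fun k => (z k : ℂ)) * T) i j) /
        ((a i + a j) / 2) := by
  set Z := S * diagonal (fun k => (z k : ℂ)) * T with hZ
  set Y := S * diagonal (fun k => ((z k / r k : ℝ) : ℂ)) * T with hY
  have h0 : 0 ≤ ∑ i, ∑ j, Complex.normSq (Z i j - (((a i + a j) / 2 : ℝ) : ℂ) * Y i j) /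
      ((a i + a j) / 2) :=
    Finset.sum_nonneg fun i _ => Finset.sum_nonneg fun j _ =>
      div_nonneg (Complex.normSq_nonneg _) (by have := ha i; have := ha j; positivity)
  have h1 : ∀ i j, Complex.normSq (Z i j - (((a i + a j) / 2 : ℝ) : ℂ) * Y i j) /
      ((a i + a j) / 2) = Complex.normSq (Z i j) / ((a i + a j) / 2) -
        2 * (Z i j * (starRingEnd ℂ) (Y i j)).re + (a i + a j) / 2 * Complex.normSq (Y i j) := by
    intro i j
    have hw : (a i + a j) / 2 ≠ 0 := by have := ha i; have := ha j; positivity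
    set w := (a i + a j) / 2
    rw [Complex.normSq_sub, Complex.normSq_mul, Complex.normSq_ofReal, map_mul, Complex.conj_ofReal,
      mul_left_comm, Complex.re_ofReal_mul]
    field_simp
    ring
  simp only [h1, Finset.sum_add_distrib, Finset.sum_sub_distrib, ← Finset.mul_sum] at h0
  rw [sum_re_mul_star, hY, weighted_sum_normSq hS' hT] at h0
  have h2 : (Z * (S * diagonal (fun k => ((z k / r k : ℝ) : ℂ)) * T)ᴴ).trace.re =
      ∑ k, z k ^ 2 / r k := by
    have e : (Z * (S * diagonal (fun k => ((z k / r k : ℝ) : ℂ)) * T)ᴴ).trace =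
        (diagonal (fun k => (z k : ℂ)) * diagonal (fun k => ((z k / r k : ℝ) : ℂ))).trace := by
      rw [hZ]
      simp only [conjTranspose_mul, diagonal_conjTranspose, Matrix.mul_assoc]
      rw [← Matrix.mul_assoc T, hT, Matrix.one_mul, Matrix.trace_mul_comm S]
      simp only [Matrix.mul_assoc]
      rw [hS', Matrix.mul_one]
      congr 3
      ext k; simp
    rw [e, diagonal_mul_diagonal, trace_diagonal, Complex.re_sum]
    refine Finset.sum_congr rfl fun k _ => ?_
    rw [← Complex.ofReal_mul, Complex.ofReal_re]; ring
  have h3 : ∑ k, (z k / r k) ^ 2 * ((∑ i, a i * Complex.normSq (S i k) +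
        ∑ j, a j * Complex.normSq (T k j)) / 2) = ∑ k, z k ^ 2 / r k := by
    refine Finset.sum_congr rfl fun k _ => ?_
    rw [← hr k]
    have := (hr0 k).ne'
    field_simp
  rw [h2, h3] at h0
  linarith

/-- A Jensen-type inequality for the logarithm and matrices `S diag(z) T` with `S`, `T` unitary. -/
lemma sum_normSq_mul_log_le {S T : Matrix m m ℂ} (hS' : Sᴴ * S = 1)
    (hT : T * Tᴴ = 1) (a z : m → ℝ) (ha : ∀ i, 0 < a i) (r : m → ℝ)
    (hr : ∀ k, r k = (∑ i, a i * Complex.normSq (S i k) + ∑ j, a j * Complex.normSq (T k j)) / 2)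
    (hr0 : ∀ k, 0 < r k) :
    ∑ i, ∑ j, Complex.normSq ((S * diagonal (fun k => (z k : ℂ)) * T) i j) *
        Real.log ((a i + a j) / 2) ≤ ∑ k, z k ^ 2 * Real.log (r k) := by
  set Z := S * diagonal (fun k => (z k : ℂ)) * T with hZ
  let G : ℝ → ℝ := fun t => ∑ k, z k ^ 2 * Real.log (t + r k) -
    ∑ i, ∑ j, Complex.normSq (Z i j) * Real.log (t + (a i + a j) / 2)
  have hlog : ∀ (x t : ℝ), 0 < x → 0 ≤ t →
      HasDerivAt (fun t => Real.log (t + x)) (1 / (t + x)) t := by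
    intro x t hx ht
    simpa using ((hasDerivAt_id t).add_const x).log (by simp; positivity)
  have hder : ∀ t, 0 ≤ t → HasDerivAt G
      (∑ k, z k ^ 2 * (1 / (t + r k)) -
        ∑ i, ∑ j, Complex.normSq (Z i j) * (1 / (t + (a i + a j) / 2))) t := by
    intro t ht
    refine HasDerivAt.sub ?_ ?_
    · exact HasDerivAt.fun_sum fun k _ => (hlog _ _ (hr0 k) ht).const_mul _
    · refine HasDerivAt.fun_sum fun i _ => HasDerivAt.fun_sum fun j _ =>
        (hlog _ _ ?_ ht).const_mul _
      have := ha i; have := ha j; positivity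
  have hanti : AntitoneOn G (Set.Ici 0) := by
    apply antitoneOn_of_deriv_nonpos (convex_Ici 0)
    · intro t ht
      exact (hder t ht).continuousAt.continuousWithinAt
    · intro t ht
      rw [interior_Ici] at ht
      exact (hder t (le_of_lt ht)).differentiableAt.differentiableWithinAt
    · intro t ht
      rw [interior_Ici] at ht
      have ht0 : 0 < t := ht
      rw [(hder t ht0.le).deriv]
      have h := sum_sq_div_le hS' hT (fun i => a i + t) z
        (fun i => by have := ha i; positivity) (fun k => t + r k) (fun k => by
          simp only [add_mul, Finset.sum_add_distrib, ← Finset.mul_sum,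
            col_normSq_unitary hS', row_normSq_unitary hT, hr k]
          ring) (fun k => by have := hr0 k; positivity)
      rw [← hZ] at h
      simp only [mul_one_div]
      rw [sub_nonpos]
      refine h.trans (le_of_eq ?_)
      refine Finset.sum_congr rfl fun i _ => Finset.sum_congr rfl fun j _ => ?_
      congr 1; ring
  have hlim : Filter.Tendsto G Filter.atTop (nhds 0) := by
    have h1 : Filter.Tendsto (fun t => ∑ k, z k ^ 2 * (Real.log (t + r k) - Real.log t) -
        ∑ i, ∑ j, Complex.normSq (Z i j) * (Real.log (t + (a i + a j) / 2) - Real.log t))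
        Filter.atTop (nhds (∑ k, z k ^ 2 * 0 - ∑ i, ∑ j, Complex.normSq (Z i j) * 0)) := by
      refine Filter.Tendsto.sub ?_ ?_
      · exact tendsto_finsetSum _ fun k _ => (Real.tendsto_log_comp_add_sub_log _).const_mul _
      · exact tendsto_finsetSum _ fun i _ => tendsto_finsetSum _ fun j _ =>
          (Real.tendsto_log_comp_add_sub_log _).const_mul _
    simp only [mul_zero, Finset.sum_const_zero, sub_zero] at h1
    refine h1.congr fun t => ?_
    simp only [mul_sub, Finset.sum_sub_distrib, ← Finset.sum_mul, G]
    rw [hZ, sum_normSq_unitary_diag hS' hT]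
    ring
  have h0 : 0 ≤ G 0 := by
    refine le_of_tendsto' (hlim.comp (Filter.tendsto_atTop_mono (fun t => le_max_left t 0)
      Filter.tendsto_id)) fun t => ?_
    exact hanti (Set.mem_Ici.2 le_rfl) (Set.mem_Ici.2 (le_max_right t 0)) (le_max_right t 0)
  simp only [G, zero_add] at h0
  linarith

end LogJensen

section Mixing

variable {m : Type*} [Fintype m] [DecidableEq m]

/-- `E` is a doubly stochastic (unital and trace preserving) map in Kraus form. -/
def IsMix (E : Matrix m m ℂ → Matrix m m ℂ) : Prop :=
  ∃ (R : Type) (_ : Fintype R) (V : R → Matrix m m ℂ), (∀ f, E f = ∑ r, V r * f * (V r)ᴴ) ∧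
    ∑ r, V r * (V r)ᴴ = 1 ∧ ∑ r, (V r)ᴴ * V r = 1

lemma IsMix.exists_kernel {E : Matrix m m ℂ → Matrix m m ℂ} (hE : IsMix E) {U : Matrix m m ℂ}
    (hU : U * Uᴴ = 1) (hU' : Uᴴ * U = 1) :
    ∃ K : m → m → ℝ, (∀ i j, 0 ≤ K i j) ∧ (∀ i, ∑ j, K i j = 1) ∧ (∀ j, ∑ i, K i j = 1) ∧
      ∀ x y, (specMat U x * E (specMat U y)).trace.re = ∑ i, ∑ j, x i * y j * K i j := by
  obtain ⟨R, _, V, hV, h1, h2⟩ := hE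
  refine ⟨fun i j => ∑ r, Complex.normSq ((Uᴴ * V r * U) i j), ?_, ?_, ?_, ?_⟩
  · exact fun i j => Finset.sum_nonneg fun r _ => Complex.normSq_nonneg _
  · intro i
    rw [Finset.sum_comm]
    have e : ∀ r, ∑ j, Complex.normSq ((Uᴴ * V r * U) i j) = ((Uᴴ * (V r * (V r)ᴴ) * U) i i).re := by
      intro r
      rw [row_normSq_mul_unitary hU, ← mul_conjTranspose_diag]
      simp only [conjTranspose_mul, conjTranspose_conjTranspose, Matrix.mul_assoc]
    simp only [e]
    rw [← Complex.re_sum, ← Matrix.sum_apply, ← Finset.sum_mul, ← Finset.mul_sum, h1,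
      Matrix.mul_one, hU']
    simp
  · intro j
    rw [Finset.sum_comm]
    have e : ∀ r, ∑ i, Complex.normSq ((Uᴴ * V r * U) i j) = ((Uᴴ * ((V r)ᴴ * V r) * U) j j).re := by
      intro r
      rw [Matrix.mul_assoc, col_normSq_unitary_mul (by simpa using hU)]
      have := mul_conjTranspose_diag (V r * U)ᴴ j
      simp only [conjTranspose_apply, conjTranspose_conjTranspose, Complex.star_def,
        Complex.normSq_conj] at this
      rw [← this]
      simp only [conjTranspose_mul, Matrix.mul_assoc]
    simp only [e]
    rw [← Complex.re_sum, ← Matrix.sum_apply, ← Finset.sum_mul, ← Finset.mul_sum, h2,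
      Matrix.mul_one, hU']
    simp
  · intro x y
    rw [hV, Finset.mul_sum, Matrix.trace_sum, Complex.re_sum]
    simp only [← Matrix.mul_assoc, trace_specMat_mul, Finset.mul_sum]
    rw [Finset.sum_comm]
    refine Finset.sum_congr rfl fun i _ => ?_
    rw [Finset.sum_comm]

/-- The (unnormalised) Dirichlet form of `1 - E`. -/
noncomputable def dform (E : Matrix m m ℂ → Matrix m m ℂ) (f : Matrix m m ℂ) : ℝ :=
  (f * (f - E f)).trace.re

lemma trace_specMat_sq {U : Matrix m m ℂ} (hU' : Uᴴ * U = 1) (x : m → ℝ) :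
    (specMat U x * specMat U x).trace.re = ∑ i, x i ^ 2 := by
  rw [specMat_mul hU', trace_specMat hU']
  exact Finset.sum_congr rfl fun i _ => by ring

lemma IsMix.dform_abs_le {E : Matrix m m ℂ → Matrix m m ℂ} (hE : IsMix E) {U : Matrix m m ℂ}
    (hU : U * Uᴴ = 1) (hU' : Uᴴ * U = 1) (x : m → ℝ) :
    dform E (specMat U fun i => |x i|) ≤ dform E (specMat U x) := by
  obtain ⟨K, h0, -, -, hK⟩ := hE.exists_kernel hU hU'
  unfold dform
  simp only [Matrix.mul_sub, Matrix.trace_sub, Complex.sub_re, hK, trace_specMat_sq hU', sq_abs]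
  refine sub_le_sub_left (Finset.sum_le_sum fun i _ => Finset.sum_le_sum fun j _ => ?_) _
  refine mul_le_mul_of_nonneg_right ?_ (h0 i j)
  rw [← abs_mul]; exact le_abs_self _

lemma IsMix.dform_add_const {E : Matrix m m ℂ → Matrix m m ℂ} (hE : IsMix E) {U : Matrix m m ℂ}
    (hU : U * Uᴴ = 1) (hU' : Uᴴ * U = 1) (x : m → ℝ) (c : ℝ) :
    dform E (specMat U fun i => x i + c) = dform E (specMat U x) := by
  obtain ⟨K, h0, hr, hc, hK⟩ := hE.exists_kernel hU hU'
  have key : ∀ x : m → ℝ, dform E (specMat U x) = ∑ i, ∑ j, (x i - x j) ^ 2 / 2 * K i j := by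
    intro x
    unfold dform
    simp only [Matrix.mul_sub, Matrix.trace_sub, Complex.sub_re, hK, trace_specMat_sq hU']
    have e1 : ∑ i, x i ^ 2 = ∑ i, ∑ j, x i ^ 2 * K i j := by
      simp [← Finset.mul_sum, hr]
    have e2 : ∑ i, x i ^ 2 = ∑ i, ∑ j, x j ^ 2 * K i j := by
      rw [Finset.sum_comm]; simp [← Finset.mul_sum, hc]
    have e3 : ∑ i, x i ^ 2 = ∑ i, ∑ j, (x i ^ 2 / 2 + x j ^ 2 / 2) * K i j := by
      have : ∀ i j, (x i ^ 2 / 2 + x j ^ 2 / 2) * K i j =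
        (x i ^ 2 * K i j + x j ^ 2 * K i j) / 2 := fun i j => by ring
      simp only [this, ← Finset.sum_div, Finset.sum_add_distrib]
      rw [← e1, ← e2]; ring
    rw [e3]
    simp only [← Finset.sum_sub_distrib]
    refine Finset.sum_congr rfl fun i _ => Finset.sum_congr rfl fun j _ => ?_
    ring
  rw [key, key]
  simp

lemma trace_mul_conjTranspose_nonneg {ι : Type*} [Fintype ι] (A : Matrix ι ι ℂ) :
    0 ≤ (A * Aᴴ).trace.re := by
  rw [Matrix.trace, Complex.re_sum]
  refine Finset.sum_nonneg fun i _ => ?_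
  rw [diag_apply, mul_conjTranspose_diag]
  exact Finset.sum_nonneg fun k _ => Complex.normSq_nonneg _

lemma trace_mul_le_of_isHermitian {ι : Type*} [Fintype ι] {A B : Matrix ι ι ℂ}
    (hA : A.IsHermitian) (hB : B.IsHermitian)
    {a b : ℝ} (hb : 0 < b) (hAa : (A * A).trace.re = a ^ 2)
    (hBb : (B * B).trace.re = b ^ 2) (ha : 0 < a) : (A * B).trace.re ≤ a * b := by
  have h := trace_mul_conjTranspose_nonneg ((b : ℂ) • A - (a : ℂ) • B)
  have e : ((b : ℂ) • A - (a : ℂ) • B)ᴴ = (b : ℂ) • A - (a : ℂ) • B := by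
    rw [conjTranspose_sub, conjTranspose_smul, conjTranspose_smul, hA.eq, hB.eq]; simp
  rw [e] at h
  simp only [Matrix.sub_mul, Matrix.mul_sub, Matrix.trace_sub, Matrix.smul_mul, Matrix.mul_smul,
    Matrix.trace_smul, smul_eq_mul, Complex.sub_re, Complex.re_ofReal_mul, hAa, hBb] at h
  rw [Matrix.trace_mul_comm B A] at h
  have h2 : 0 ≤ (2 * (a * b)) * (a * b - (A * B).trace.re) := by nlinarith
  have := nonneg_of_mul_nonneg_right h2 (by positivity)
  linarith

/-- Entropy of `(D + O)²` for a splitting into even and odd parts. -/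
lemma sum_sq_log_sq_le_split {U Q W W' : Matrix m m ℂ} (hU : U * Uᴴ = 1) (hU' : Uᴴ * U = 1)
    (hQ : Q * Qᴴ = 1) (hQ' : Qᴴ * Q = 1) (hW : W * Wᴴ = 1) (hW' : Wᴴ * W = 1)
    (hV : W' * W'ᴴ = 1) (hV' : W'ᴴ * W' = 1) {a x z : m → ℝ} (ha : ∀ i, 0 < a i)
    (h1 : specMat U a = specMat W x + specMat W' z)
    (h2 : specMat Q a = specMat W x - specMat W' z) :
    let H := specMat W x * specMat W x + specMat W' z * specMat W' z
    (∀ k, 0 < ((Wᴴ * H * W) k k).re) ∧ (∀ k, 0 < ((W'ᴴ * H * W') k k).re) ∧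
    ∑ i, a i ^ 2 * Real.log (a i ^ 2) ≤ ∑ k, x k ^ 2 * Real.log (((Wᴴ * H * W) k k).re) +
      ∑ k, z k ^ 2 * Real.log (((W'ᴴ * H * W') k k).re) + 2 * ∑ k, z k ^ 2 := by
  intro H
  have hH : H = (1 / 2 : ℂ) • (specMat U (fun i => a i ^ 2) + specMat Q (fun i => a i ^ 2)) := by
    have e1 : specMat U (fun i => a i ^ 2) = specMat U a * specMat U a := by
      rw [specMat_mul hU']; simp only [pow_two]
    have e2 : specMat Q (fun i => a i ^ 2) = specMat Q a * specMat Q a := by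
      rw [specMat_mul hQ']; simp only [pow_two]
    rw [e1, e2, h1, h2]
    simp only [H, Matrix.add_mul, Matrix.mul_add, Matrix.sub_mul, Matrix.mul_sub]
    module
  have hr : ∀ (T : Matrix m m ℂ) (k : m), ((Tᴴ * H * T) k k).re =
      (∑ i, a i ^ 2 * Complex.normSq ((Uᴴ * T) i k) +
        ∑ j, a j ^ 2 * Complex.normSq ((Tᴴ * Q) k j)) / 2 := by
    intro T k
    have e : ∀ j, Complex.normSq ((Tᴴ * Q) k j) = Complex.normSq ((Qᴴ * T) j k) := by
      intro j
      rw [show Tᴴ * Q = (Qᴴ * T)ᴴ by simp [conjTranspose_mul], conjTranspose_apply,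
        Complex.star_def, Complex.normSq_conj]
    simp only [e]
    rw [← specMat_conj_apply, ← specMat_conj_apply, ← Complex.add_re, ← Matrix.add_apply, hH]
    simp only [Matrix.mul_smul, Matrix.smul_mul, Matrix.mul_add, Matrix.add_mul, Matrix.smul_apply,
      smul_eq_mul, Matrix.add_apply]
    simp
    ring
  have hpos : ∀ (T : Matrix m m ℂ), T * Tᴴ = 1 → Tᴴ * T = 1 → ∀ k, 0 < ((Tᴴ * H * T) k k).re := by
    intro T hT hT' k
    have hu : (Uᴴ * T)ᴴ * (Uᴴ * T) = 1 := by
      simp only [conjTranspose_mul, conjTranspose_conjTranspose, Matrix.mul_assoc]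
      rw [← Matrix.mul_assoc U, hU, Matrix.one_mul, hT']
    have h := col_normSq_unitary hu k
    obtain ⟨i, -, hi⟩ := Finset.exists_ne_zero_of_sum_ne_zero (by rw [h]; exact one_ne_zero)
    rw [hr]
    have p1 : 0 < ∑ i, a i ^ 2 * Complex.normSq ((Uᴴ * T) i k) := by
      refine Finset.sum_pos' (fun i _ => by have := Complex.normSq_nonneg ((Uᴴ * T) i k); positivity)
        ⟨i, Finset.mem_univ _, ?_⟩
      have h3 := (Complex.normSq_nonneg ((Uᴴ * T) i k)).lt_of_ne' hi
      have := ha i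
      positivity
    have p2 : 0 ≤ ∑ j, a j ^ 2 * Complex.normSq ((Tᴴ * Q) k j) :=
      Finset.sum_nonneg fun i _ => by have := Complex.normSq_nonneg ((Tᴴ * Q) k i); positivity
    linarith
  refine ⟨hpos W hW hW', hpos W' hV hV', ?_⟩
  set N := Uᴴ * Q with hN
  have hNN : N * Nᴴ = 1 := by
    rw [hN]
    simp only [conjTranspose_mul, conjTranspose_conjTranspose, Matrix.mul_assoc]
    rw [← Matrix.mul_assoc Q, hQ, Matrix.one_mul, hU']
  have hNN' : Nᴴ * N = 1 := by
    rw [hN]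
    simp only [conjTranspose_mul, conjTranspose_conjTranspose, Matrix.mul_assoc]
    rw [← Matrix.mul_assoc U, hU, Matrix.one_mul, hQ']
  have e1 : Uᴴ * specMat U a * Q = diagonal (fun i => (a i : ℂ)) * N := by
    simp only [specMat, hN, ← Matrix.mul_assoc]; rw [hU', Matrix.one_mul]
  have e2 : Uᴴ * specMat Q a * Q = N * diagonal (fun i => (a i : ℂ)) := by
    simp only [specMat, hN, Matrix.mul_assoc]; rw [hQ', Matrix.mul_one]
  have hX : ∀ i j, (Uᴴ * specMat W x * Q) i j = (((a i + a j) / 2 : ℝ) : ℂ) * N i j := by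
    intro i j
    have : Uᴴ * specMat W x * Q = (1 / 2 : ℂ) • (diagonal (fun i => (a i : ℂ)) * N +
        N * diagonal (fun i => (a i : ℂ))) := by
      rw [← e1, ← e2, h1, h2]
      simp only [Matrix.add_mul, Matrix.mul_add, Matrix.sub_mul, Matrix.mul_sub]
      module
    rw [this]
    simp only [Matrix.smul_apply, Matrix.add_apply, diagonal_mul, mul_diagonal, smul_eq_mul]
    push_cast; ring
  have hY : ∀ i j, (Uᴴ * specMat W' z * Q) i j = (((a i - a j) / 2 : ℝ) : ℂ) * N i j := by
    intro i j
    have : Uᴴ * specMat W' z * Q = (1 / 2 : ℂ) • (diagonal (fun i => (a i : ℂ)) * N -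
        N * diagonal (fun i => (a i : ℂ))) := by
      rw [← e1, ← e2, h1, h2]
      simp only [Matrix.add_mul, Matrix.mul_add, Matrix.sub_mul, Matrix.mul_sub]
      module
    rw [this]
    simp only [Matrix.smul_apply, Matrix.sub_apply, diagonal_mul, mul_diagonal, smul_eq_mul]
    push_cast; ring
  have hjl : ∀ (T : Matrix m m ℂ) (y : m → ℝ), T * Tᴴ = 1 → Tᴴ * T = 1 →
      ∑ i, ∑ j, Complex.normSq ((Uᴴ * specMat T y * Q) i j) * Real.log ((a i ^ 2 + a j ^ 2) / 2) ≤
        ∑ k, y k ^ 2 * Real.log (((Tᴴ * H * T) k k).re) ∧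
      ∑ i, ∑ j, Complex.normSq ((Uᴴ * specMat T y * Q) i j) = ∑ k, y k ^ 2 := by
    intro T y hT hT'
    have hS' : (Uᴴ * T)ᴴ * (Uᴴ * T) = 1 := by
      simp only [conjTranspose_mul, conjTranspose_conjTranspose, Matrix.mul_assoc]
      rw [← Matrix.mul_assoc U, hU, Matrix.one_mul, hT']
    have hT2 : (Tᴴ * Q) * (Tᴴ * Q)ᴴ = 1 := by
      simp only [conjTranspose_mul, conjTranspose_conjTranspose, Matrix.mul_assoc]
      rw [← Matrix.mul_assoc Q, hQ, Matrix.one_mul, hT']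
    have e : Uᴴ * specMat T y * Q = (Uᴴ * T) * diagonal (fun k => (y k : ℂ)) * (Tᴴ * Q) := by
      simp only [specMat, Matrix.mul_assoc]
    rw [e]
    exact ⟨sum_normSq_mul_log_le hS' hT2 (fun i => a i ^ 2) y
      (fun i => by have := ha i; positivity) _ (hr T) (hpos T hT hT'),
      sum_normSq_unitary_diag hS' hT2 y⟩
  obtain ⟨j1, -⟩ := hjl W x hW hW'
  obtain ⟨j2, j3⟩ := hjl W' z hV hV'
  simp only [hX, hY, Complex.normSq_mul, Complex.normSq_ofReal] at j1 j2 j3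
  have hsum : ∑ i, a i ^ 2 * Real.log (a i ^ 2) = ∑ i, ∑ j, Complex.normSq (N i j) *
      ((a i ^ 2 * Real.log (a i ^ 2) + a j ^ 2 * Real.log (a j ^ 2)) / 2) := by
    have : ∀ i j, Complex.normSq (N i j) *
      ((a i ^ 2 * Real.log (a i ^ 2) + a j ^ 2 * Real.log (a j ^ 2)) / 2) =
      (a i ^ 2 * Real.log (a i ^ 2) * Complex.normSq (N i j) +
        a j ^ 2 * Real.log (a j ^ 2) * Complex.normSq (N i j)) / 2 := fun i j => by ring
    simp only [this, ← Finset.sum_div, Finset.sum_add_distrib, ← Finset.mul_sum,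
      row_normSq_unitary hNN]
    rw [Finset.sum_comm (f := fun i j => a j ^ 2 * Real.log (a j ^ 2) * Complex.normSq (N i j))]
    simp only [← Finset.mul_sum, col_normSq_unitary hNN']
    simp
  rw [hsum]
  have hle : ∑ i, ∑ j, Complex.normSq (N i j) *
      ((a i ^ 2 * Real.log (a i ^ 2) + a j ^ 2 * Real.log (a j ^ 2)) / 2) ≤
      ∑ i, ∑ j, ((a i + a j) / 2 * ((a i + a j) / 2) * Complex.normSq (N i j) *
          Real.log ((a i ^ 2 + a j ^ 2) / 2) +
        (a i - a j) / 2 * ((a i - a j) / 2) * Complex.normSq (N i j) *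
          Real.log ((a i ^ 2 + a j ^ 2) / 2) +
        2 * ((a i - a j) / 2 * ((a i - a j) / 2) * Complex.normSq (N i j))) := by
    refine Finset.sum_le_sum fun i _ => Finset.sum_le_sum fun j _ => ?_
    have h := mul_le_mul_of_nonneg_left (two_point_log_sobolev (ha i) (ha j))
      (Complex.normSq_nonneg (N i j))
    nlinarith [h]
  refine hle.trans ?_
  simp only [Finset.sum_add_distrib, ← Finset.mul_sum]
  rw [j3]
  linarith

end Mixing

section Blocks

variable {m : Type*} [Fintype m] [DecidableEq m]

/-- Apply a map to each of the four blocks of a matrix. -/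
def blockMap (E : Matrix m m ℂ → Matrix m m ℂ) (f : Matrix (m ⊕ m) (m ⊕ m) ℂ) :
    Matrix (m ⊕ m) (m ⊕ m) ℂ :=
  fromBlocks (E f.toBlocks₁₁) (E f.toBlocks₁₂) (E f.toBlocks₂₁) (E f.toBlocks₂₂)

/-- Average the two diagonal blocks and delete the off-diagonal ones. -/
noncomputable def blockAvg (f : Matrix (m ⊕ m) (m ⊕ m) ℂ) : Matrix (m ⊕ m) (m ⊕ m) ℂ :=
  fromBlocks ((1 / 2 : ℂ) • (f.toBlocks₁₁ + f.toBlocks₂₂)) 0 0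
    ((1 / 2 : ℂ) • (f.toBlocks₁₁ + f.toBlocks₂₂))

lemma fromBlocks_sum {m R : Type*} (s : Finset R) (A B C D : R → Matrix m m ℂ) :
    ∑ r ∈ s, fromBlocks (A r) (B r) (C r) (D r) =
      fromBlocks (∑ r ∈ s, A r) (∑ r ∈ s, B r) (∑ r ∈ s, C r) (∑ r ∈ s, D r) := by
  ext i j
  rcases i with i | i <;> rcases j with j | j <;> simp [Matrix.sum_apply]

lemma trace_blocks {m : Type*} [Fintype m] (A B C D : Matrix m m ℂ) :
    (fromBlocks A B C D).trace = A.trace + D.trace := by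
  simp [Matrix.trace, Fintype.sum_sum_type]

lemma IsMix.blockMap {E : Matrix m m ℂ → Matrix m m ℂ} (hE : IsMix E) : IsMix (blockMap E) := by
  obtain ⟨R, _, V, hV, h1, h2⟩ := hE
  refine ⟨R, inferInstance, fun r => fromBlocks (V r) 0 0 (V r), ?_, ?_, ?_⟩
  · intro f
    conv_rhs => rw [← fromBlocks_toBlocks f]
    simp only [_root_.blockMap, hV, fromBlocks_conjTranspose, fromBlocks_multiply,
      conjTranspose_zero, Matrix.zero_mul, Matrix.mul_zero, add_zero, zero_add, fromBlocks_sum]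
  · simp only [fromBlocks_conjTranspose, fromBlocks_multiply,
      conjTranspose_zero, Matrix.zero_mul, Matrix.mul_zero, add_zero, zero_add, fromBlocks_sum, h1]
    simp
  · simp only [fromBlocks_conjTranspose, fromBlocks_multiply,
      conjTranspose_zero, Matrix.zero_mul, Matrix.mul_zero, add_zero, zero_add, fromBlocks_sum, h2]
    simp

lemma dform_blockMap_diag (E : Matrix m m ℂ → Matrix m m ℂ) (A B : Matrix m m ℂ) :
    dform (blockMap E) (fromBlocks A 0 0 B) = dform E A + dform E B := by
  simp [dform, blockMap, sub_eq_add_neg, fromBlocks_neg, fromBlocks_add, fromBlocks_multiply,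
    trace_blocks]

lemma dform_blockMap_add (E : Matrix m m ℂ → Matrix m m ℂ) (A B C D : Matrix m m ℂ) :
    dform (blockMap E) (fromBlocks A C D B) =
      dform E A + dform E B + dform (blockMap E) (fromBlocks 0 C D 0) := by
  simp [dform, blockMap, sub_eq_add_neg, fromBlocks_neg, fromBlocks_add, fromBlocks_multiply,
    trace_blocks]
  ring

/-- The logarithmic Sobolev inequality with the Dirichlet form `∑ k, dform (E k)`. -/
def LogSob {m K : Type*} [Fintype m] [DecidableEq m] [Fintype K]
    (E : K → Matrix m m ℂ → Matrix m m ℂ) : Prop :=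
  ∀ (U : Matrix m m ℂ) (a : m → ℝ), U * Uᴴ = 1 → Uᴴ * U = 1 → (∀ i, 0 ≤ a i) →
    ∑ i, a i ^ 2 * Real.log (a i ^ 2) ≤
      (∑ i, a i ^ 2) * Real.log (∑ i, a i ^ 2) - (∑ i, a i ^ 2) * Real.log (Fintype.card m) +
        2 * ∑ k, dform (E k) (specMat U a)

/-- It suffices to prove the logarithmic Sobolev inequality for positive definite matrices. -/
lemma logSob_of_pos {K : Type*} [Fintype K] {E : K → Matrix m m ℂ → Matrix m m ℂ}
    (hE : ∀ k, IsMix (E k))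
    (h : ∀ (U : Matrix m m ℂ) (a : m → ℝ), U * Uᴴ = 1 → Uᴴ * U = 1 → (∀ i, 0 < a i) →
      ∑ i, a i ^ 2 * Real.log (a i ^ 2) ≤
        (∑ i, a i ^ 2) * Real.log (∑ i, a i ^ 2) - (∑ i, a i ^ 2) * Real.log (Fintype.card m) +
          2 * ∑ k, dform (E k) (specMat U a)) : LogSob E := by
  intro U a hU hU' ha
  have key : ∀ ε : ℝ, 0 < ε → ∑ i, (a i + ε) ^ 2 * Real.log ((a i + ε) ^ 2) ≤
        (∑ i, (a i + ε) ^ 2) * Real.log (∑ i, (a i + ε) ^ 2) -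
          (∑ i, (a i + ε) ^ 2) * Real.log (Fintype.card m) +
          2 * ∑ k, dform (E k) (specMat U a) := by
    intro ε hε
    have := h U (fun i => a i + ε) hU hU' (fun i => by have := ha i; positivity)
    simpa only [(hE _).dform_add_const hU hU'] using this
  have c0 : Continuous fun ε : ℝ => ∑ i, (a i + ε) ^ 2 := by fun_prop
  have c1 : Continuous fun ε : ℝ => ∑ i, (a i + ε) ^ 2 * Real.log ((a i + ε) ^ 2) :=
    continuous_finsetSum _ fun i _ =>
      Real.continuous_mul_log.comp (by fun_prop : Continuous fun ε : ℝ => (a i + ε) ^ 2)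
  have c2 : Continuous fun ε : ℝ => (∑ i, (a i + ε) ^ 2) * Real.log (∑ i, (a i + ε) ^ 2) -
          (∑ i, (a i + ε) ^ 2) * Real.log (Fintype.card m) +
          2 * ∑ k, dform (E k) (specMat U a) :=
    ((Real.continuous_mul_log.comp c0).sub (c0.mul continuous_const)).add continuous_const
  have t1 := (c1.tendsto 0).mono_left (nhdsWithin_le_nhds (s := Set.Ioi 0))
  have t2 := (c2.tendsto 0).mono_left (nhdsWithin_le_nhds (s := Set.Ioi 0))
  have := le_of_tendsto_of_tendsto t1 t2 (by
    filter_upwards [self_mem_nhdsWithin] with ε hε using key ε hε)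
  simpa using this

lemma specMat_blocks (U V : Matrix m m ℂ) (x y : m → ℝ) :
    specMat (fromBlocks U 0 0 V) (Sum.elim x y) = fromBlocks (specMat U x) 0 0 (specMat V y) := by
  have : (diagonal fun i => ((Sum.elim x y i : ℝ) : ℂ)) =
      fromBlocks (diagonal fun i => (x i : ℂ)) 0 0 (diagonal fun i => (y i : ℂ)) := by
    rw [fromBlocks_diagonal]
    congr 1
    ext i; rcases i with i | i <;> simp
  rw [specMat, this]
  simp only [specMat, fromBlocks_conjTranspose, fromBlocks_multiply, conjTranspose_zero,
    Matrix.zero_mul, Matrix.mul_zero, add_zero, zero_add]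

lemma specMat_mul_left (U : Matrix m m ℂ) (V : Matrix m m ℂ) (x : m → ℝ) :
    specMat (V * U) x = V * specMat U x * Vᴴ := by
  simp [specMat, Matrix.mul_assoc]

set_option maxHeartbeats 1000000 in
/-- Tensorisation: adding one qubit. -/
lemma LogSob.block [Nonempty m] {K : Type*} [Fintype K] {E : K → Matrix m m ℂ → Matrix m m ℂ}
    (hE : ∀ k, IsMix (E k)) (h : LogSob E)
    (U : Matrix (m ⊕ m) (m ⊕ m) ℂ) (a : m ⊕ m → ℝ) (hU : U * Uᴴ = 1) (hU' : Uᴴ * U = 1)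
    (ha : ∀ i, 0 < a i) :
    ∑ i, a i ^ 2 * Real.log (a i ^ 2) ≤
      (∑ i, a i ^ 2) * Real.log (∑ i, a i ^ 2) -
        (∑ i, a i ^ 2) * Real.log (Fintype.card (m ⊕ m)) +
        2 * (dform blockAvg (specMat U a) + ∑ k, dform (blockMap (E k)) (specMat U a)) := by
  have hfh := specMat_isHermitian U a
  obtain ⟨A, C, B, hf, hA, hB⟩ : ∃ A C B : Matrix m m ℂ, specMat U a = fromBlocks A C Cᴴ B ∧
      A.IsHermitian ∧ B.IsHermitian := by
    have h0 := fromBlocks_toBlocks (specMat U a)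
    have h1 : (specMat U a)ᴴ = specMat U a := hfh
    rw [← h0, fromBlocks_conjTranspose, fromBlocks_inj] at h1
    refine ⟨_, (specMat U a).toBlocks₁₂, _, ?_, h1.1, h1.2.2.2⟩
    rw [h1.2.2.1]; exact h0.symm
  obtain ⟨WA, x, hWA, hWA', hAx⟩ := exists_specMat hA
  obtain ⟨WB, y, hWB, hWB', hBy⟩ := exists_specMat hB
  have hOh : (fromBlocks 0 C Cᴴ 0 : Matrix (m ⊕ m) (m ⊕ m) ℂ).IsHermitian := by
    simp [IsHermitian, fromBlocks_conjTranspose]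
  obtain ⟨W', z, hV, hV', hO⟩ := exists_specMat hOh
  obtain ⟨V1, y1, hV1, hV1', hC1⟩ := exists_specMat (isHermitian_mul_conjTranspose_self C)
  obtain ⟨V2, y2, hV2, hV2', hC2⟩ := exists_specMat (isHermitian_conjTranspose_mul_self C)
  have hy1 : ∀ i, 0 ≤ y1 i := nonneg_of_specMat_posSemidef hV1'
    (hC1 ▸ posSemidef_self_mul_conjTranspose C)
  have hy2 : ∀ i, 0 ≤ y2 i := nonneg_of_specMat_posSemidef hV2'
    (hC2 ▸ posSemidef_conjTranspose_mul_self C)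
  have blkU : ∀ P Q : Matrix m m ℂ, P * Pᴴ = 1 → Q * Qᴴ = 1 →
      (fromBlocks P 0 0 Q) * (fromBlocks P 0 0 Q)ᴴ = 1 := by
    intro P Q hP hQ
    simp [fromBlocks_conjTranspose, fromBlocks_multiply, hP, hQ]
  have blkU' : ∀ P Q : Matrix m m ℂ, Pᴴ * P = 1 → Qᴴ * Q = 1 →
      (fromBlocks P 0 0 Q)ᴴ * (fromBlocks P 0 0 Q) = 1 := by
    intro P Q hP hQ
    simp [fromBlocks_conjTranspose, fromBlocks_multiply, hP, hQ]
  set W := fromBlocks WA 0 0 WB with hWdef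
  have hW : W * Wᴴ = 1 := blkU _ _ hWA hWB
  have hW' : Wᴴ * W = 1 := blkU' _ _ hWA' hWB'
  have hD : specMat W (Sum.elim x y) = fromBlocks A 0 0 B := by
    rw [hWdef, specMat_blocks, ← hAx, ← hBy]
  set Z : Matrix (m ⊕ m) (m ⊕ m) ℂ := fromBlocks 1 0 0 (-1) with hZ
  have hZZ : Z * Zᴴ = 1 := blkU _ _ (by simp) (by simp)
  have hZZ' : Zᴴ * Z = 1 := blkU' _ _ (by simp) (by simp)
  have hQ : (Z * U) * (Z * U)ᴴ = 1 := by
    rw [conjTranspose_mul, Matrix.mul_assoc, ← Matrix.mul_assoc U, hU, Matrix.one_mul, hZZ]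
  have hQ' : (Z * U)ᴴ * (Z * U) = 1 := by
    rw [conjTranspose_mul, Matrix.mul_assoc, ← Matrix.mul_assoc Zᴴ, hZZ', Matrix.one_mul, hU']
  have s1 : specMat U a = specMat W (Sum.elim x y) + specMat W' z := by
    rw [hD, ← hO, hf, fromBlocks_add]; simp
  have s2 : specMat (Z * U) a = specMat W (Sum.elim x y) - specMat W' z := by
    rw [specMat_mul_left, hD, ← hO, hf, sub_eq_add_neg, fromBlocks_neg, fromBlocks_add, hZ]
    simp [fromBlocks_conjTranspose, fromBlocks_multiply]
  obtain ⟨r1, r2, hsplit⟩ := sum_sq_log_sq_le_split hU hU' hQ hQ' hW hW' hV hV' ha s1 s2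
  have hO2 : specMat W' z * specMat W' z = fromBlocks (C * Cᴴ) 0 0 (Cᴴ * C) := by
    rw [← hO, fromBlocks_multiply]; simp
  have hD2 : specMat W (Sum.elim x y) * specMat W (Sum.elim x y) =
      fromBlocks (A * A) 0 0 (B * B) := by
    rw [hD, fromBlocks_multiply]; simp
  rw [hO2, hD2, fromBlocks_add] at r1 r2 hsplit
  simp only [add_zero] at r1 r2 hsplit
  set H := fromBlocks (A * A + C * Cᴴ) 0 0 (B * B + Cᴴ * C) with hH
  -- eigenvalues of the diagonal blocks are positive
  have hxy : ∀ k, 0 < (Sum.elim x y k : ℝ) := by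
    intro k
    have e1 : ((Wᴴ * specMat U a * W) k k).re = Sum.elim x y k := by
      have : ((Wᴴ * specMat W' z * W) k k).re = 0 := by
        rw [← hO, hWdef]
        rcases k with k | k <;> simp [fromBlocks_conjTranspose, fromBlocks_multiply]
      rw [s1, Matrix.mul_add, Matrix.add_mul, Matrix.add_apply, Complex.add_re, this,
        specMat_coeff hW']
      simp
    rw [← e1, specMat_conj_apply]
    have hu : (Uᴴ * W)ᴴ * (Uᴴ * W) = 1 := by
      simp only [conjTranspose_mul, conjTranspose_conjTranspose, Matrix.mul_assoc]
      rw [← Matrix.mul_assoc U, hU, Matrix.one_mul, hW']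
    have h := col_normSq_unitary hu k
    obtain ⟨i, -, hi⟩ := Finset.exists_ne_zero_of_sum_ne_zero (by rw [h]; exact one_ne_zero)
    refine Finset.sum_pos' (fun i _ => mul_nonneg (ha i).le (Complex.normSq_nonneg _))
        ⟨i, Finset.mem_univ _, mul_pos (ha i) ((Complex.normSq_nonneg _).lt_of_ne' hi)⟩
  have hx : ∀ k, 0 < x k := fun k => hxy (Sum.inl k)
  have hy : ∀ k, 0 < y k := fun k => hxy (Sum.inr k)
  set sa := ∑ k, x k ^ 2 with hsa
  set sb := ∑ k, y k ^ 2 with hsb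
  set sc := (C * Cᴴ).trace.re with hsc
  have hsa0 : 0 < sa := Finset.sum_pos (fun k _ => by have := hx k; positivity) Finset.univ_nonempty
  have hsb0 : 0 < sb := Finset.sum_pos (fun k _ => by have := hy k; positivity) Finset.univ_nonempty
  have hsc0 : 0 ≤ sc := trace_mul_conjTranspose_nonneg C
  have tA : (A * A).trace.re = sa := by rw [hAx, trace_specMat_sq hWA']
  have tB : (B * B).trace.re = sb := by rw [hBy, trace_specMat_sq hWB']
  have tC : (Cᴴ * C).trace.re = sc := by rw [Matrix.trace_mul_comm]
  have sz : ∑ k, z k ^ 2 = 2 * sc := by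
    rw [← trace_specMat_sq hV', hO2, trace_blocks, Complex.add_re, tC]; ring
  have sumaa : ∑ i, a i ^ 2 = sa + sb + 2 * sc := by
    rw [← trace_specMat_sq hU', hf, fromBlocks_multiply, trace_blocks]
    simp only [Matrix.trace_add, Complex.add_re, tA, tB, tC, ← hsc]; ring
  have ctr : ∀ (P T : Matrix m m ℂ), P * Pᴴ = 1 → (Pᴴ * T * P).trace = T.trace := by
    intro P T hP
    rw [Matrix.mul_assoc, Matrix.trace_mul_comm, Matrix.mul_assoc, hP, Matrix.mul_one]
  -- Gibbs on each block
  have gA := gibbs_inequality (fun k => x k ^ 2) (fun k => ((Wᴴ * H * W) (Sum.inl k) (Sum.inl k)).re)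
    (fun k => sq_nonneg _) (fun k => r1 _)
  have gB := gibbs_inequality (fun k => y k ^ 2) (fun k => ((Wᴴ * H * W) (Sum.inr k) (Sum.inr k)).re)
    (fun k => sq_nonneg _) (fun k => r1 _)
  have gO := gibbs_inequality (fun k => z k ^ 2) (fun k => ((W'ᴴ * H * W') k k).re)
    (fun k => sq_nonneg _) (fun k => r2 _)
  have RA : ∑ k, ((Wᴴ * H * W) (Sum.inl k) (Sum.inl k)).re = sa + sc := by
    have : ∀ k, (Wᴴ * H * W) (Sum.inl k) (Sum.inl k) = (WAᴴ * (A * A + C * Cᴴ) * WA) k k := by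
      intro k
      rw [hWdef, hH]; simp [fromBlocks_conjTranspose, fromBlocks_multiply]
    simp only [this]
    rw [← tA, hsc, ← Complex.add_re, ← Matrix.trace_add, ← ctr WA _ hWA, Matrix.trace,
      Complex.re_sum]
    rfl
  have RB : ∑ k, ((Wᴴ * H * W) (Sum.inr k) (Sum.inr k)).re = sb + sc := by
    have : ∀ k, (Wᴴ * H * W) (Sum.inr k) (Sum.inr k) = (WBᴴ * (B * B + Cᴴ * C) * WB) k k := by
      intro k
      rw [hWdef, hH]; simp [fromBlocks_conjTranspose, fromBlocks_multiply]
    simp only [this]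
    rw [← tB, ← tC, ← Complex.add_re, ← Matrix.trace_add, ← ctr WB _ hWB, Matrix.trace,
      Complex.re_sum]
    rfl
  have RO : ∑ k, ((W'ᴴ * H * W') k k).re = sa + sb + 2 * sc := by
    have e : (W'ᴴ * H * W').trace = H.trace := by
      rw [Matrix.mul_assoc, Matrix.trace_mul_comm, Matrix.mul_assoc, hV, Matrix.mul_one]
    have e2 : ∑ k, ((W'ᴴ * H * W') k k).re = (W'ᴴ * H * W').trace.re := by
      rw [Matrix.trace, Complex.re_sum]; rfl
    rw [e2, e, hH, trace_blocks]
    simp only [Matrix.trace_add, Complex.add_re, tA, tB, tC, ← hsc]; ring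
  simp only [RA, RB, RO, sz, ← hsa, ← hsb] at gA gB gO
  -- the absolute value of the off-diagonal part
  have hsq : specMat W' (fun k => z k ^ 2) = specMat (fromBlocks V1 0 0 V2) (Sum.elim y1 y2) := by
    rw [specMat_blocks, ← hC1, ← hC2, ← hO2, specMat_mul hV']
    simp only [pow_two]
  have habs : specMat W' (fun k => |z k|) = fromBlocks (specMat V1 fun k => Real.sqrt (y1 k)) 0 0
      (specMat V2 fun k => Real.sqrt (y2 k)) := by
    have := specMat_comp_eq hV hV' (blkU _ _ hV1 hV2) (blkU' _ _ hV1' hV2') hsq Real.sqrt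
    simp only [Real.sqrt_sq_eq_abs] at this
    rw [this, ← specMat_blocks]
    congr 1
    ext k; rcases k with k | k <;> rfl
  have hent := (sum_comp_eq_of_specMat_eq hV hV' (blkU _ _ hV1 hV2) (blkU' _ _ hV1' hV2') hsq
    (fun t => t * Real.log t)).trans (Fintype.sum_sum_type _)
  simp only [Sum.elim_inl, Sum.elim_inr] at hent
  have iA := h WA x hWA hWA' (fun k => (hx k).le)
  have iB := h WB y hWB hWB' (fun k => (hy k).le)
  have i1 := h V1 (fun k => Real.sqrt (y1 k)) hV1 hV1' (fun k => Real.sqrt_nonneg _)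
  have i2 := h V2 (fun k => Real.sqrt (y2 k)) hV2 hV2' (fun k => Real.sqrt_nonneg _)
  simp only [Real.sq_sqrt (hy1 _), Real.sq_sqrt (hy2 _)] at i1 i2
  have sy1 : ∑ k, y1 k = sc := by rw [hsc, hC1, trace_specMat hV1']
  have sy2 : ∑ k, y2 k = sc := by rw [← tC, hC2, trace_specMat hV2']
  rw [sy1] at i1
  rw [sy2] at i2
  rw [← hAx, ← hsa] at iA
  rw [← hBy, ← hsb] at iB
  have dK : ∀ k, dform (E k) A + dform (E k) B +
      (dform (E k) (specMat V1 fun k => Real.sqrt (y1 k)) +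
        dform (E k) (specMat V2 fun k => Real.sqrt (y2 k))) ≤
      dform (blockMap (E k)) (specMat U a) := by
    intro k
    rw [hf, dform_blockMap_add, ← dform_blockMap_diag, ← dform_blockMap_diag, ← habs, hO]
    have := (hE k).blockMap.dform_abs_le hV hV' z
    linarith
  have dKs := Finset.sum_le_sum fun k (_ : k ∈ Finset.univ) => dK k
  simp only [Finset.sum_add_distrib] at dKs
  -- the averaging term
  obtain ⟨p, hp0, hp⟩ : ∃ p, 0 < p ∧ p ^ 2 = sa := ⟨Real.sqrt sa, Real.sqrt_pos.2 hsa0,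
    Real.sq_sqrt hsa0.le⟩
  obtain ⟨q, hq0, hq⟩ : ∃ q, 0 < q ∧ q ^ 2 = sb := ⟨Real.sqrt sb, Real.sqrt_pos.2 hsb0,
    Real.sq_sqrt hsb0.le⟩
  have hAB := trace_mul_le_of_isHermitian hA hB hq0 (tA.trans hp.symm) (tB.trans hq.symm) hp0
  have dAvg : dform blockAvg (specMat U a) = 2 * sc + (sa + sb) / 2 - (A * B).trace.re := by
    rw [hf, dform, blockAvg]
    have half : ∀ w : ℂ, ((1 / 2 : ℂ) * w).re = w.re / 2 := by
      intro w
      have : (1 / 2 : ℂ) = ((1 / 2 : ℝ) : ℂ) := by push_cast; rfl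
      rw [this, Complex.re_ofReal_mul]; ring
    simp only [toBlocks_fromBlocks₁₁, toBlocks_fromBlocks₂₂, sub_eq_add_neg, fromBlocks_neg,
      fromBlocks_add, fromBlocks_multiply, trace_blocks, neg_zero, add_zero, Matrix.mul_add,
      Matrix.mul_neg, Matrix.mul_smul, Matrix.trace_add, Matrix.trace_neg, Matrix.trace_smul,
      Complex.add_re, Complex.neg_re, smul_eq_mul, half, tA, tB, tC, ← hsc, Matrix.trace_mul_comm B A]
    ring
  have hshift := two_point_shift hp0 hq0 hsc0
  rw [hp, hq] at hshift
  have hcard : Real.log (Fintype.card (m ⊕ m)) = Real.log 2 + Real.log (Fintype.card m) := by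
    rw [Fintype.card_sum, ← two_mul, Nat.cast_mul, Real.log_mul (by norm_num)
      (by exact_mod_cast Fintype.card_ne_zero)]
    norm_num
  have hT : Real.log ((sa + sb) / 2 + sc) = Real.log (sa + sb + 2 * sc) - Real.log 2 := by
    rw [← Real.log_div (by positivity) (by norm_num)]
    congr 1; ring
  have h2c : 2 * sc * Real.log (2 * sc) = 2 * sc * Real.log 2 + 2 * (sc * Real.log sc) := by
    rcases hsc0.eq_or_lt' with h0 | h0
    · rw [h0]; simp
    · rw [Real.log_mul (by norm_num) h0.ne']; ring
  rw [Fintype.sum_sum_type (f := fun k => Sum.elim x y k ^ 2 * Real.log ((Wᴴ * H * W) k k).re)]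
    at hsplit
  simp only [Sum.elim_inl, Sum.elim_inr] at hsplit
  rw [sz] at hsplit
  rw [sumaa, hcard, dAvg]
  rw [hT] at hshift
  have hpq : (p - q) ^ 2 = sa + sb - 2 * (p * q) := by rw [← hp, ← hq]; ring
  rw [hpq] at hshift
  linarith

end Blocks

section Reindex

variable {m N : Type*} [Fintype m] [DecidableEq m] [Fintype N] [DecidableEq N]

lemma trace_submatrix_equiv {m N : Type*} [Fintype m] [Fintype N] (e : m ≃ N) (A : Matrix N N ℂ) :
    (A.submatrix e e).trace = A.trace := by
  simp only [Matrix.trace, diag_apply, submatrix_apply]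
  exact e.sum_comp fun i => A i i

lemma specMat_submatrix (e : m ≃ N) (U : Matrix N N ℂ) (a : N → ℝ) :
    (specMat U a).submatrix e e = specMat (U.submatrix e e) (a ∘ e) := by
  have : (diagonal fun i => ((a ∘ e) i : ℂ)) = (diagonal fun i => (a i : ℂ)).submatrix e e := by
    rw [submatrix_diagonal_equiv]; rfl
  rw [specMat, specMat, this, conjTranspose_submatrix, submatrix_mul_equiv, submatrix_mul_equiv]

lemma dform_submatrix {m N : Type*} [Fintype m] [Fintype N] (e : m ≃ N)
    {E : Matrix N N ℂ → Matrix N N ℂ} {F : Matrix m m ℂ → Matrix m m ℂ}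
    (f : Matrix N N ℂ) (h : (E f).submatrix e e = F (f.submatrix e e)) :
    dform E f = dform F (f.submatrix e e) := by
  have : f.submatrix e e - (E f).submatrix e e = (f - E f).submatrix e e := rfl
  rw [dform, dform, ← h, this, submatrix_mul_equiv, trace_submatrix_equiv]

lemma IsMix.submatrix (e : m ≃ N) {E : Matrix N N ℂ → Matrix N N ℂ}
    {F : Matrix m m ℂ → Matrix m m ℂ} (hF : IsMix F) (h : ∀ f, (E f).submatrix e e = F (f.submatrix e e)) : IsMix E := by
  obtain ⟨R, _, V, hV, h1, h2⟩ := hF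
  refine ⟨R, inferInstance, fun r => (V r).submatrix e.symm e.symm, fun f => ?_, ?_, ?_⟩
  · have : E f = (F (f.submatrix e e)).submatrix e.symm e.symm := by rw [← h]; simp
    rw [this, hV]
    ext i j
    simp only [submatrix_apply, Matrix.sum_apply]
    refine Finset.sum_congr rfl fun r _ => ?_
    have : (V r).submatrix e.symm e.symm * f * ((V r).submatrix e.symm e.symm)ᴴ =
        (V r * f.submatrix e e * (V r)ᴴ).submatrix e.symm e.symm := by
      rw [← submatrix_mul_equiv _ _ e.symm e.symm e.symm,
        ← submatrix_mul_equiv _ _ e.symm e.symm e.symm]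
      simp
    rw [this]; rfl
  · have : ∀ r, (V r).submatrix e.symm e.symm * ((V r).submatrix e.symm e.symm)ᴴ =
        (V r * (V r)ᴴ).submatrix e.symm e.symm := fun r => by simp
    simp only [this]
    have h3 := congrArg (fun A => A.submatrix e.symm e.symm) h1
    simp only [submatrix_one_equiv] at h3
    rw [← h3]
    ext i j; simp [Matrix.sum_apply]
  · have : ∀ r, ((V r).submatrix e.symm e.symm)ᴴ * (V r).submatrix e.symm e.symm =
        ((V r)ᴴ * (V r)).submatrix e.symm e.symm := fun r => by simp
    simp only [this]
    have h3 := congrArg (fun A => A.submatrix e.symm e.symm) h2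
    simp only [submatrix_one_equiv] at h3
    rw [← h3]
    ext i j; simp [Matrix.sum_apply]

end Reindex

lemma isMix_blockAvg {m : Type*} [Fintype m] [DecidableEq m] :
    IsMix (blockAvg : Matrix (m ⊕ m) (m ⊕ m) ℂ → _) := by
  have hs : ((Real.sqrt (1 / 2) : ℝ) : ℂ) * ((Real.sqrt (1 / 2) : ℝ) : ℂ) = 1 / 2 := by
    rw [← Complex.ofReal_mul, Real.mul_self_sqrt (by norm_num)]; push_cast; rfl
  set s : ℂ := ((Real.sqrt (1 / 2) : ℝ) : ℂ) with hsdef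
  have hst : star s = s := by simp [hsdef]
  refine ⟨Fin 2 × Fin 2, inferInstance, fun r =>
    !![fromBlocks (s • 1) 0 0 0, fromBlocks 0 (s • 1) 0 0;
      fromBlocks 0 0 (s • 1) 0, fromBlocks 0 0 0 (s • 1)] r.1 r.2, fun f => ?_, ?_, ?_⟩
  · conv_rhs => rw [← fromBlocks_toBlocks f]
    rw [Fintype.sum_prod_type]
    simp [fromBlocks_conjTranspose, fromBlocks_multiply, fromBlocks_add, hst, smul_smul, hs,
      blockAvg]
  · rw [Fintype.sum_prod_type]
    simp [fromBlocks_conjTranspose, fromBlocks_multiply, fromBlocks_add, hst, smul_smul, hs,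
      ← add_smul]
    norm_num
  · rw [Fintype.sum_prod_type]
    simp [fromBlocks_conjTranspose, fromBlocks_multiply, fromBlocks_add, hst, smul_smul, hs,
      ← add_smul]
    norm_num

/-- Split off the first qubit. -/
def qubitEquiv (n : ℕ) : (Fin n → Fin 2) ⊕ (Fin n → Fin 2) ≃ (Fin (n + 1) → Fin 2) where
  toFun := Sum.elim (fun x => Fin.cons (α := fun _ => Fin 2) 0 x)
    (fun x => Fin.cons (α := fun _ => Fin 2) 1 x)
  invFun x := if x 0 = 0 then Sum.inl (Fin.tail x) else Sum.inr (Fin.tail x)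
  left_inv x := by rcases x with x | x <;> simp
  right_inv x := by
    by_cases h : x 0 = 0
    · simp only [h, if_true, Sum.elim_inl]
      rw [← h]; exact Fin.cons_self_tail x
    · have h1 : x 0 = 1 := by omega
      simp only [h, if_false, Sum.elim_inr]
      rw [← h1]; exact Fin.cons_self_tail x

lemma depolAt_zero_submatrix {n : ℕ} (f : Matrix (Fin (n + 1) → Fin 2) (Fin (n + 1) → Fin 2) ℂ) :
    (depolAt 0 0 f).submatrix (qubitEquiv n) (qubitEquiv n) =
      blockAvg (f.submatrix (qubitEquiv n) (qubitEquiv n)) := by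
  ext i j
  rcases i with i | i <;> rcases j with j | j <;>
    simp [depolAt, blockAvg, qubitEquiv, toBlocks₁₁, toBlocks₂₂, mul_add]

lemma depolAt_succ_submatrix {n : ℕ} (k : Fin n)
    (f : Matrix (Fin (n + 1) → Fin 2) (Fin (n + 1) → Fin 2) ℂ) :
    (depolAt 0 k.succ f).submatrix (qubitEquiv n) (qubitEquiv n) =
      blockMap (depolAt 0 k) (f.submatrix (qubitEquiv n) (qubitEquiv n)) := by
  ext i j
  rcases i with i | i <;> rcases j with j | j <;>
    simp [depolAt, blockMap, qubitEquiv, toBlocks₁₁, toBlocks₂₂, toBlocks₁₂, toBlocks₂₁,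
      Fin.cons_update]

lemma isMix_depolAt : ∀ {n : ℕ} (k : Fin n), IsMix (depolAt 0 k)
  | 0, k => k.elim0
  | n + 1, k => by
    refine Fin.cases ?_ (fun k => ?_) k
    · exact isMix_blockAvg.submatrix (qubitEquiv n) depolAt_zero_submatrix
    · exact (isMix_depolAt k).blockMap.submatrix (qubitEquiv n) (depolAt_succ_submatrix k)

/-- The logarithmic Sobolev inequality for the qubit depolarizing semigroup. -/
lemma logSob_depolAt : ∀ n : ℕ, LogSob (fun k : Fin n => depolAt (n := n) 0 k)
  | 0 => by
    intro U a hU hU' ha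
    simp
  | n + 1 => by
    refine logSob_of_pos (fun k => isMix_depolAt k) fun U a hU hU' ha => ?_
    set e := qubitEquiv n with he
    have h := (logSob_depolAt n).block (fun k => isMix_depolAt k) (U.submatrix e e) (a ∘ e)
      (by rw [conjTranspose_submatrix, submatrix_mul_equiv, hU, submatrix_one_equiv])
      (by rw [conjTranspose_submatrix, submatrix_mul_equiv, hU', submatrix_one_equiv])
      (fun i => ha _)
    rw [← specMat_submatrix, ← dform_submatrix e _ (depolAt_zero_submatrix _)] at h
    have h2 : ∀ k, dform (blockMap (depolAt 0 k)) ((specMat U a).submatrix e e) =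
        dform (depolAt 0 k.succ) (specMat U a) :=
      fun k => (dform_submatrix e _ (depolAt_succ_submatrix k _)).symm
    simp only [h2] at h
    rw [Fintype.card_congr e] at h
    rw [Fin.sum_univ_succ]
    have h3 := e.sum_comp fun i => a i ^ 2
    have h4 := e.sum_comp fun i => a i ^ 2 * Real.log (a i ^ 2)
    simp only [Function.comp_apply] at h
    rw [h3, h4] at h
    exact h

/-- The two-point Stroock–Varopoulos inequality in the reverse regime `0 < p < 1`. -/
lemma stroock_varopoulos_scalar {p x y : ℝ} (hp0 : 0 < p) (hp1 : p < 1) (hx : 0 < x) (hy : 0 < y) :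
    (x ^ (p / 2) - y ^ (p / 2)) ^ 2 ≤
      p ^ 2 / (4 * (1 - p)) * ((x - y) * (y ^ (p - 1) - x ^ (p - 1))) := by
  wlog hxy : y ≤ x generalizing x y with H
  · have := H hy hx (le_of_not_ge hxy)
    calc (x ^ (p / 2) - y ^ (p / 2)) ^ 2 = (y ^ (p / 2) - x ^ (p / 2)) ^ 2 := by ring
      _ ≤ _ := this
      _ = _ := by ring
  have hp1' : 0 < 1 - p := by linarith
  have key : ∀ l : ℝ, 0 ≤ (y ^ (p - 1) - x ^ (p - 1)) / (1 - p) * (l * l) +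
      (-2 * (2 / p * (x ^ (p / 2) - y ^ (p / 2)))) * l + (x - y) := by
    intro l
    let G : ℝ → ℝ := fun t => - (t ^ (p - 1) / (1 - p)) * (l * l) - 4 / p * l * t ^ (p / 2) + t
    have hder : ∀ t, 0 < t → HasDerivAt G ((l * t ^ (p / 2 - 1) - 1) ^ 2) t := by
      intro t ht
      have h1 := Real.hasDerivAt_rpow_const (p := p - 1) (Or.inl ht.ne')
      have h2 := Real.hasDerivAt_rpow_const (p := p / 2) (Or.inl ht.ne')
      have h3 := (((h1.div_const (1 - p)).neg.mul_const (l * l)).sub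
        (h2.const_mul (4 / p * l))).add (hasDerivAt_id t)
      refine h3.congr_deriv ?_
      have e : t ^ (p - 1 - 1) = t ^ (p / 2 - 1) * t ^ (p / 2 - 1) := by
        rw [← Real.rpow_add ht]; congr 1; ring
      rw [e]
      have e2 : p - 1 = -(1 - p) := by ring
      rw [e2]
      field_simp
      ring
    have hmono : MonotoneOn G (Set.Ici y) := by
      apply monotoneOn_of_deriv_nonneg (convex_Ici y)
      · intro t ht
        exact (hder t (hy.trans_le ht)).continuousAt.continuousWithinAt
      · intro t ht
        rw [interior_Ici] at ht
        exact (hder t (hy.trans ht)).differentiableAt.differentiableWithinAt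
      · intro t ht
        rw [interior_Ici] at ht
        rw [(hder t (hy.trans ht)).deriv]
        positivity
    have h := hmono (Set.mem_Ici.2 le_rfl) (Set.mem_Ici.2 hxy) hxy
    simp only [G] at h
    have e : (y ^ (p - 1) - x ^ (p - 1)) / (1 - p) * (l * l) +
      (-2 * (2 / p * (x ^ (p / 2) - y ^ (p / 2)))) * l + (x - y) =
      (-(x ^ (p - 1) / (1 - p)) * (l * l) - 4 / p * l * x ^ (p / 2) + x) -
      (-(y ^ (p - 1) / (1 - p)) * (l * l) - 4 / p * l * y ^ (p / 2) + y) := by ring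
    rw [e]; linarith
  have hd := discrim_le_zero key
  unfold discrim at hd
  have e1 : (-2 * (2 / p * (x ^ (p / 2) - y ^ (p / 2)))) ^ 2 =
      16 / p ^ 2 * (x ^ (p / 2) - y ^ (p / 2)) ^ 2 := by field_simp; ring
  have e2 : 4 * ((y ^ (p - 1) - x ^ (p - 1)) / (1 - p)) * (x - y) =
      16 / p ^ 2 * (p ^ 2 / (4 * (1 - p)) * ((x - y) * (y ^ (p - 1) - x ^ (p - 1)))) := by
    field_simp; ring
  rw [e1, e2, sub_nonpos] at hd
  exact le_of_mul_le_mul_left hd (by positivity)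

section Entropy

variable {m : Type*} [Fintype m] [DecidableEq m]

lemma dform_rpow_le {E : Matrix m m ℂ → Matrix m m ℂ} (hE : IsMix E) (hR : IsReversible E)
    {U : Matrix m m ℂ} (hU : U * Uᴴ = 1) (hU' : Uᴴ * U = 1) {x : m → ℝ} (hx : ∀ i, 0 < x i)
    {p : ℝ} (hp0 : 0 < p) (hp1 : p < 1) :
    dform E (specMat U fun i => x i ^ (p / 2)) ≤
      p ^ 2 / (4 * (1 - p)) *
        (specMat U (fun i => x i ^ (p - 1)) * (E (specMat U x) - specMat U x)).trace.re := by
  obtain ⟨K, h0, hr, hc, hK⟩ := hE.exists_kernel hU hU'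
  have hsymm : ∀ x y : m → ℝ, ∑ i, ∑ j, x i * y j * K i j = ∑ i, ∑ j, y i * x j * K i j := by
    intro x y
    rw [← hK, ← hK, hR, Matrix.trace_mul_comm]
  have hdiag : ∀ x y : m → ℝ, ∑ i, ∑ j, x i * y i * K i j = ∑ i, x i * y i := by
    intro x y; simp [← Finset.mul_sum, hr]
  have hdiag' : ∀ x y : m → ℝ, ∑ i, ∑ j, x j * y j * K i j = ∑ i, x i * y i := by
    intro x y; rw [Finset.sum_comm]; simp [← Finset.mul_sum, hc]
  have key : ∀ x y : m → ℝ, (specMat U x * (specMat U y - E (specMat U y))).trace.re =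
      ∑ i, ∑ j, K i j * ((x i - x j) * (y i - y j)) / 2 := by
    intro x y
    simp only [Matrix.mul_sub, Matrix.trace_sub, Complex.sub_re, hK, specMat_mul hU',
      trace_specMat hU']
    have e : ∀ i j, K i j * ((x i - x j) * (y i - y j)) / 2 =
        (x i * y i * K i j + x j * y j * K i j - x i * y j * K i j - y i * x j * K i j) / 2 :=
      fun i j => by ring
    simp only [e, ← Finset.sum_div, Finset.sum_sub_distrib, Finset.sum_add_distrib]
    rw [hdiag, hdiag', hsymm y x]
    ring
  have e : ∀ x y : m → ℝ, (specMat U x * (E (specMat U y) - specMat U y)).trace.re =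
      - ∑ i, ∑ j, K i j * ((x i - x j) * (y i - y j)) / 2 := by
    intro x y
    rw [← key, ← Complex.neg_re, ← Matrix.trace_neg, ← Matrix.mul_neg, neg_sub]
  rw [dform, key, e, ← Finset.sum_neg_distrib, Finset.mul_sum]
  refine Finset.sum_le_sum fun i _ => ?_
  rw [← Finset.sum_neg_distrib, Finset.mul_sum]
  refine Finset.sum_le_sum fun j _ => ?_
  have h := mul_le_mul_of_nonneg_left (stroock_varopoulos_scalar hp0 hp1 (hx i) (hx j))
    (div_nonneg (h0 i j) (zero_le_two))
  refine le_trans (le_of_eq ?_) (h.trans (le_of_eq ?_)) <;> ring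

/-- The entropy of `f ^ p` is controlled by the `p`-Dirichlet form. -/
lemma LogSob.rpow {K : Type*} [Fintype K] {E : K → Matrix m m ℂ → Matrix m m ℂ}
    (h : LogSob E) (hE : ∀ k, IsMix (E k)) (hR : ∀ k, IsReversible (E k))
    {U : Matrix m m ℂ} (hU : U * Uᴴ = 1) (hU' : Uᴴ * U = 1) {x : m → ℝ} (hx : ∀ i, 0 < x i)
    {p : ℝ} (hp0 : 0 < p) (hp1 : p < 1) :
    p * ∑ i, x i ^ p * Real.log (x i) - (∑ i, x i ^ p) * Real.log (∑ i, x i ^ p) +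
        (∑ i, x i ^ p) * Real.log (Fintype.card m) ≤
      p ^ 2 / (2 * (1 - p)) * (specMat U (fun i => x i ^ (p - 1)) *
        ∑ k, (E k (specMat U x) - specMat U x)).trace.re := by
  have h1 := h U (fun i => x i ^ (p / 2)) hU hU' fun i => (Real.rpow_pos_of_pos (hx i) _).le
  have e : ∀ i, (x i ^ (p / 2)) ^ 2 = x i ^ p := by
    intro i
    rw [← Real.rpow_natCast, ← Real.rpow_mul (hx i).le]; congr 1; push_cast; ring
  simp only [e, Real.log_rpow (hx _)] at h1
  have h2 := Finset.sum_le_sum fun k (_ : k ∈ Finset.univ) =>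
    dform_rpow_le (hE k) (hR k) hU hU' hx hp0 hp1
  rw [← Finset.mul_sum] at h2
  have e3 : (specMat U (fun i => x i ^ (p - 1)) *
        ∑ k, (E k (specMat U x) - specMat U x)).trace.re = ∑ k, (specMat U (fun i => x i ^ (p - 1)) *
         (E k (specMat U x) - specMat U x)).trace.re := by
    rw [Finset.mul_sum, Matrix.trace_sum, Complex.re_sum]
  rw [e3]
  have e4 : ∑ i, x i ^ p * (p * Real.log (x i)) = p * ∑ i, x i ^ p * Real.log (x i) := by
    rw [Finset.mul_sum]; exact Finset.sum_congr rfl fun i _ => by ring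
  rw [e4] at h1
  have e5 : p ^ 2 / (2 * (1 - p)) = 2 * (p ^ 2 / (4 * (1 - p))) := by
    have : (1 - p) ≠ 0 := by linarith
    field_simp; ring
  rw [e5]
  linarith

/-- Klein's inequality for the concave power `t ↦ t ^ p`. -/
lemma klein_rpow {U V : Matrix m m ℂ} (hU : U * Uᴴ = 1) (hU' : Uᴴ * U = 1) (hV : V * Vᴴ = 1)
    (hV' : Vᴴ * V = 1) {a b : m → ℝ} (ha : ∀ i, 0 < a i) (hb : ∀ i, 0 < b i) {p : ℝ}
    (hp0 : 0 < p) (hp1 : p < 1) :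
    ∑ j, b j ^ p ≤ ∑ i, ((1 - p) * a i ^ p +
      p * a i ^ (p - 1) * ((Uᴴ * specMat V b * U) i i).re) := by
  set c : m → m → ℝ := fun j i => Complex.normSq ((Vᴴ * U) j i) with hc
  have u1 : (Vᴴ * U) * (Vᴴ * U)ᴴ = 1 := by
    simp only [conjTranspose_mul, conjTranspose_conjTranspose, Matrix.mul_assoc]
    rw [← Matrix.mul_assoc U, hU, Matrix.one_mul, hV']
  have u2 : (Vᴴ * U)ᴴ * (Vᴴ * U) = 1 := by
    simp only [conjTranspose_mul, conjTranspose_conjTranspose, Matrix.mul_assoc]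
    rw [← Matrix.mul_assoc V, hV, Matrix.one_mul, hU']
  have hrow : ∀ j, ∑ i, c j i = 1 := row_normSq_unitary u1
  have hcol : ∀ i, ∑ j, c j i = 1 := col_normSq_unitary u2
  have tangent : ∀ s t : ℝ, 0 < s → 0 < t → t ^ p ≤ (1 - p) * s ^ p + p * s ^ (p - 1) * t := by
    intro s t hs ht
    have h := rpow_one_add_le_one_add_mul_self (s := t / s - 1)
      (by have : 0 < t / s := by positivity
          linarith) hp0.le hp1.le
    have e : 1 + (t / s - 1) = t / s := by ring
    rw [e, Real.div_rpow ht.le hs.le, div_le_iff₀ (Real.rpow_pos_of_pos hs p)] at h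
    refine h.trans (le_of_eq ?_)
    rw [Real.rpow_sub_one hs.ne']
    field_simp
    ring
  calc ∑ j, b j ^ p = ∑ j, ∑ i, c j i * b j ^ p := by simp [← Finset.sum_mul, hrow]
    _ ≤ ∑ j, ∑ i, c j i * ((1 - p) * a i ^ p + p * a i ^ (p - 1) * b j) :=
        Finset.sum_le_sum fun j _ => Finset.sum_le_sum fun i _ =>
          mul_le_mul_of_nonneg_left (tangent _ _ (ha i) (hb j)) (Complex.normSq_nonneg _)
    _ = ∑ i, ∑ j, c j i * ((1 - p) * a i ^ p + p * a i ^ (p - 1) * b j) := Finset.sum_comm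
    _ = _ := by
        refine Finset.sum_congr rfl fun i _ => ?_
        rw [specMat_conj_apply]
        simp only [mul_add, Finset.sum_add_distrib, ← Finset.sum_mul, hcol, Finset.mul_sum, one_mul]
        congr 1
        exact Finset.sum_congr rfl fun j _ => by simp only [hc]; ring

end Entropy

lemma IsReversible.blockMap {m : Type*} [Fintype m] [DecidableEq m]
    {E : Matrix m m ℂ → Matrix m m ℂ} (hE : IsReversible E) : IsReversible (blockMap E) := by
  intro f g
  conv_lhs => rw [← fromBlocks_toBlocks f]
  conv_rhs => rw [← fromBlocks_toBlocks g]
  simp only [_root_.blockMap, fromBlocks_multiply, trace_blocks, Matrix.trace_add, hE _ _]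

lemma isReversible_blockAvg {m : Type*} [Fintype m] [DecidableEq m] :
    IsReversible (blockAvg : Matrix (m ⊕ m) (m ⊕ m) ℂ → _) := by
  intro f g
  conv_lhs => rw [← fromBlocks_toBlocks f]
  conv_rhs => rw [← fromBlocks_toBlocks g]
  simp [blockAvg, fromBlocks_multiply, trace_blocks, Matrix.mul_add, Matrix.add_mul]
  ring

lemma IsReversible.submatrix {m N : Type*} [Fintype m] [DecidableEq m] [Fintype N] [DecidableEq N]
    (e : m ≃ N) {E : Matrix N N ℂ → Matrix N N ℂ} {F : Matrix m m ℂ → Matrix m m ℂ}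
    (hF : IsReversible F) (h : ∀ f, (E f).submatrix e e = F (f.submatrix e e)) :
    IsReversible E := by
  intro f g
  rw [← trace_submatrix_equiv e, ← trace_submatrix_equiv e (E f * g), ← submatrix_mul_equiv _ _ e e,
    ← submatrix_mul_equiv _ _ e e, h, h, hF]

section Depolarizing

lemma isReversible_depolAt_zero : ∀ {n : ℕ} (k : Fin n), IsReversible (depolAt 0 k)
  | 0, k => k.elim0
  | n + 1, k => by
    refine Fin.cases ?_ (fun k => ?_) k
    · exact isReversible_blockAvg.submatrix (qubitEquiv n) depolAt_zero_submatrix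
    · exact (isReversible_depolAt_zero k).blockMap.submatrix (qubitEquiv n)
        (depolAt_succ_submatrix k)

variable {n : ℕ}

lemma depolAt_eq (γ : ℝ) (k : Fin n) (f : Matrix (Fin n → Fin 2) (Fin n → Fin 2) ℂ) :
    depolAt γ k f = (γ : ℂ) • f + ((1 - γ : ℝ) : ℂ) • depolAt 0 k f := by
  ext x y; simp [depolAt]

lemma depolAt_add (γ : ℝ) (k : Fin n) (f g : Matrix (Fin n → Fin 2) (Fin n → Fin 2) ℂ) :
    depolAt γ k (f + g) = depolAt γ k f + depolAt γ k g := by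
  ext x y
  simp only [depolAt, of_apply, Matrix.add_apply, Finset.sum_add_distrib]
  split_ifs <;> ring

lemma depolAt_smul (γ : ℝ) (k : Fin n) (c : ℂ) (f : Matrix (Fin n → Fin 2) (Fin n → Fin 2) ℂ) :
    depolAt γ k (c • f) = c • depolAt γ k f := by
  ext x y
  simp only [depolAt, of_apply, Matrix.smul_apply, smul_eq_mul, ← Finset.mul_sum]
  split_ifs <;> ring

lemma depolAt_zero_idem (k : Fin n) (f : Matrix (Fin n → Fin 2) (Fin n → Fin 2) ℂ) :
    depolAt 0 k (depolAt 0 k f) = depolAt 0 k f := by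
  ext x y
  simp [depolAt]

lemma depolAt_zero_comm (j k : Fin n) (f : Matrix (Fin n → Fin 2) (Fin n → Fin 2) ℂ) :
    depolAt 0 j (depolAt 0 k f) = depolAt 0 k (depolAt 0 j f) := by
  rcases eq_or_ne j k with rfl | h
  · rfl
  ext x y
  simp [depolAt, h, h.symm, Function.update_of_ne, Function.update_comm h]
  split_ifs <;> ring

lemma depolAt_comm (γ δ : ℝ) (j k : Fin n) (f : Matrix (Fin n → Fin 2) (Fin n → Fin 2) ℂ) :
    depolAt γ j (depolAt δ k f) = depolAt δ k (depolAt γ j f) := by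
  simp only [depolAt_eq γ, depolAt_eq δ, depolAt_add, depolAt_smul, depolAt_zero_comm j k]
  module

lemma depolAt_depolAt (γ δ : ℝ) (k : Fin n) (f : Matrix (Fin n → Fin 2) (Fin n → Fin 2) ℂ) :
    depolAt γ k (depolAt δ k f) = depolAt (γ * δ) k f := by
  rw [depolAt_eq γ, depolAt_eq δ, depolAt_eq (γ * δ), depolAt_add, depolAt_smul, depolAt_smul,
    depolAt_zero_idem]
  push_cast
  module

lemma isReversible_depolAt (γ : ℝ) (k : Fin n) : IsReversible (depolAt γ k) := by
  intro f g
  simp [depolAt_eq γ, Matrix.mul_add, Matrix.add_mul, isReversible_depolAt_zero k f g]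

lemma depolAt_one_left (k : Fin n) (f : Matrix (Fin n → Fin 2) (Fin n → Fin 2) ℂ) :
    depolAt 1 k f = f := by
  rw [depolAt_eq]; simp

lemma IsMix.map_one {m : Type*} [Fintype m] [DecidableEq m] {E : Matrix m m ℂ → Matrix m m ℂ}
    (hE : IsMix E) : E 1 = 1 := by
  obtain ⟨R, _, V, hV, h1, h2⟩ := hE
  simp [hV, h1]

lemma IsMix.posSemidef {m : Type*} [Fintype m] [DecidableEq m] {E : Matrix m m ℂ → Matrix m m ℂ}
    (hE : IsMix E) {f : Matrix m m ℂ} (hf : f.PosSemidef) : (E f).PosSemidef := by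
  obtain ⟨R, _, V, hV, h1, h2⟩ := hE
  rw [hV]
  exact Matrix.posSemidef_sum _ fun r _ => hf.mul_mul_conjTranspose_same (V r)

lemma depolAt_one (γ : ℝ) (k : Fin n) : depolAt γ k 1 = 1 := by
  rw [depolAt_eq, (isMix_depolAt k).map_one, ← add_smul]
  push_cast; simp

lemma depolAt_posSemidef {γ : ℝ} (h0 : 0 ≤ γ) (h1 : γ ≤ 1) (k : Fin n)
    {f : Matrix (Fin n → Fin 2) (Fin n → Fin 2) ℂ} (hf : f.PosSemidef) :
    (depolAt γ k f).PosSemidef := by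
  rw [depolAt_eq]
  exact (hf.smul (by exact_mod_cast h0)).add
    (((isMix_depolAt k).posSemidef hf).smul (by exact_mod_cast sub_nonneg.2 h1))

/-- The depolarizing channel acting on the qubits of a list. -/
noncomputable def depolList (γ : ℝ) (l : List (Fin n))
    (f : Matrix (Fin n → Fin 2) (Fin n → Fin 2) ℂ) :
    Matrix (Fin n → Fin 2) (Fin n → Fin 2) ℂ :=
  l.foldl (fun g k => depolAt γ k g) f

lemma depolList_cons (γ : ℝ) (k : Fin n) (l : List (Fin n))
    (f : Matrix (Fin n → Fin 2) (Fin n → Fin 2) ℂ) :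
    depolList γ (k :: l) f = depolList γ l (depolAt γ k f) := rfl

lemma depolList_add (γ : ℝ) (l : List (Fin n)) (f g : Matrix (Fin n → Fin 2) (Fin n → Fin 2) ℂ) :
    depolList γ l (f + g) = depolList γ l f + depolList γ l g := by
  induction l generalizing f g with
  | nil => rfl
  | cons k l ih => simp only [depolList_cons, depolAt_add, ih]

lemma depolList_smul (γ : ℝ) (l : List (Fin n)) (c : ℂ)
    (f : Matrix (Fin n → Fin 2) (Fin n → Fin 2) ℂ) :
    depolList γ l (c • f) = c • depolList γ l f := by
  induction l generalizing f with
  | nil => rfl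
  | cons k l ih => simp only [depolList_cons, depolAt_smul, ih]

lemma depolAt_depolList_comm (γ δ : ℝ) (k : Fin n) (l : List (Fin n))
    (f : Matrix (Fin n → Fin 2) (Fin n → Fin 2) ℂ) :
    depolAt γ k (depolList δ l f) = depolList δ l (depolAt γ k f) := by
  induction l generalizing f with
  | nil => rfl
  | cons j l ih => simp only [depolList_cons, ih, depolAt_comm γ δ]

lemma depolList_depolList (γ δ : ℝ) (l : List (Fin n))
    (f : Matrix (Fin n → Fin 2) (Fin n → Fin 2) ℂ) :
    depolList γ l (depolList δ l f) = depolList (γ * δ) l f := by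
  induction l generalizing f with
  | nil => rfl
  | cons k l ih => simp only [depolList_cons, depolAt_depolList_comm, ih, depolAt_depolAt]

lemma depolList_one_left (l : List (Fin n)) (f : Matrix (Fin n → Fin 2) (Fin n → Fin 2) ℂ) :
    depolList 1 l f = f := by
  induction l generalizing f with
  | nil => rfl
  | cons k l ih => rw [depolList_cons, ih, depolAt_one_left]

lemma depolList_one (γ : ℝ) (l : List (Fin n)) : depolList γ l 1 = 1 := by
  induction l with
  | nil => rfl
  | cons k l ih => rw [depolList_cons, depolAt_one, ih]

lemma isReversible_depolList (γ : ℝ) (l : List (Fin n)) : IsReversible (depolList γ l) := by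
  intro f g
  induction l generalizing f g with
  | nil => rfl
  | cons k l ih =>
    rw [depolList_cons, depolList_cons, ih, isReversible_depolAt, depolAt_depolList_comm]

lemma depolList_posSemidef {γ : ℝ} (h0 : 0 ≤ γ) (h1 : γ ≤ 1) (l : List (Fin n))
    {f : Matrix (Fin n → Fin 2) (Fin n → Fin 2) ℂ} (hf : f.PosSemidef) :
    (depolList γ l f).PosSemidef := by
  induction l generalizing f with
  | nil => exact hf
  | cons k l ih => exact ih (depolAt_posSemidef h0 h1 k hf)

lemma hasDerivAt_depolAt (k : Fin n) {δ : ℝ} {f : ℝ → Matrix (Fin n → Fin 2) (Fin n → Fin 2) ℂ}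
    {f' : Matrix (Fin n → Fin 2) (Fin n → Fin 2) ℂ}
    (hf : ∀ x y, HasDerivAt (fun s => f s x y) (f' x y) δ) (x y : Fin n → Fin 2) :
    HasDerivAt (fun s => depolAt s k (f s) x y)
      ((depolAt δ k f' + (f δ - depolAt 0 k (f δ))) x y) δ := by
  have hs : HasDerivAt (fun s : ℝ => (s : ℂ)) 1 δ := Complex.ofRealCLM.hasDerivAt
  have hE : HasDerivAt (fun s => depolAt 0 k (f s) x y) (depolAt 0 k f' x y) δ := by
    by_cases h : x k = y k
    · simp only [depolAt, of_apply, h, if_true, Fin.sum_univ_two, Complex.ofReal_zero, zero_mul,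
        zero_add, sub_zero, Complex.ofReal_one, one_mul]
      exact ((hf _ _).add (hf _ _)).const_mul _
    · simp only [depolAt, of_apply, h, if_false, Complex.ofReal_zero, zero_mul, mul_zero, add_zero]
      exact hasDerivAt_const _ _
  have h := (hs.mul (hf x y)).add (((hasDerivAt_const δ (1 : ℂ)).sub hs).mul hE)
  refine (h.congr_of_eventuallyEq (Filter.Eventually.of_forall fun s => ?_)).congr_deriv ?_
  · simp only [depolAt_eq s, Matrix.add_apply, Matrix.smul_apply, smul_eq_mul]
    push_cast; rfl
  · simp only [depolAt_eq δ, Matrix.add_apply, Matrix.sub_apply, Matrix.smul_apply, smul_eq_mul,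
      Pi.sub_apply]
    push_cast; ring

lemma hasDerivAt_depolList (l : List (Fin n)) {δ : ℝ} (hδ : δ ≠ 0)
    {f : ℝ → Matrix (Fin n → Fin 2) (Fin n → Fin 2) ℂ}
    {f' : Matrix (Fin n → Fin 2) (Fin n → Fin 2) ℂ}
    (hf : ∀ x y, HasDerivAt (fun s => f s x y) (f' x y) δ) (x y : Fin n → Fin 2) :
    HasDerivAt (fun s => depolList s l (f s) x y)
      ((depolList δ l f' + (l.map fun k => ((δ⁻¹ : ℝ) : ℂ) • (depolList δ l (f δ) -
        depolAt 0 k (depolList δ l (f δ)))).sum) x y) δ := by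
  induction l generalizing f f' with
  | nil => simpa [depolList] using hf x y
  | cons k l ih =>
    refine (ih (hasDerivAt_depolAt k hf)).congr_deriv (congrArg
      (fun A : Matrix (Fin n → Fin 2) (Fin n → Fin 2) ℂ => A x y) ?_)
    simp only [depolList_cons, List.map_cons, List.sum_cons]
    rw [depolList_add, add_assoc, add_right_inj, add_left_inj]
    have e : f δ - depolAt 0 k (f δ) = ((δ⁻¹ : ℝ) : ℂ) • (depolAt δ k (f δ) +
        (-1 : ℂ) • depolAt 0 k (depolAt δ k (f δ))) := by
      rw [depolAt_depolAt, zero_mul, depolAt_eq δ]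
      have h : (δ : ℂ) ≠ 0 := by exact_mod_cast hδ
      ext a b
      simp only [Matrix.add_apply, Matrix.sub_apply, Matrix.smul_apply, smul_eq_mul]
      push_cast
      field_simp
      ring
    rw [e, depolList_smul, depolList_add, depolList_smul, ← depolAt_depolList_comm 0]
    congr 1
    module

lemma hasDerivAt_depolChannel (g : Matrix (Fin n → Fin 2) (Fin n → Fin 2) ℂ) {δ : ℝ} (hδ : δ ≠ 0)
    (x y : Fin n → Fin 2) :
    HasDerivAt (fun s => depolChannel s g x y) ((((δ⁻¹ : ℝ) : ℂ) • ∑ k, (depolChannel δ g -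
        depolAt 0 k (depolChannel δ g))) x y) δ := by
  have h := hasDerivAt_depolList (List.finRange n) hδ (f := fun _ => g) (f' := 0)
    (fun x y => hasDerivAt_const _ _) x y
  refine h.congr_deriv (congrArg
      (fun A : Matrix (Fin n → Fin 2) (Fin n → Fin 2) ℂ => A x y) ?_)
  have h0 : depolList δ (List.finRange n) (0 : Matrix (Fin n → Fin 2) (Fin n → Fin 2) ℂ) = 0 := by
    have := depolList_smul δ (List.finRange n) 0 (0 : Matrix (Fin n → Fin 2) (Fin n → Fin 2) ℂ)
    simpa using this
  rw [h0, zero_add, Finset.smul_sum, ← List.ofFn_eq_map, List.sum_ofFn]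
  rfl

lemma continuous_depolChannel (g : Matrix (Fin n → Fin 2) (Fin n → Fin 2) ℂ)
    (x y : Fin n → Fin 2) : Continuous fun s => depolChannel s g x y := by
  have : ∀ (l : List (Fin n)) (f : ℝ → Matrix (Fin n → Fin 2) (Fin n → Fin 2) ℂ),
      (∀ x y, Continuous fun s => f s x y) → Continuous fun s => depolList s l (f s) x y := by
    intro l
    induction l with
    | nil => exact fun f hf => hf x y
    | cons k l ih =>
      intro f hf
      refine ih _ fun x y => ?_
      simp only [depolAt, of_apply]
      split_ifs
      · fun_prop
      · fun_prop
  exact this _ _ fun x y => continuous_const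

end Depolarizing

section TracePower

variable {m : Type*} [Fintype m] [DecidableEq m]

lemma trace_hermFC_specMat {U : Matrix m m ℂ} (hU : U * Uᴴ = 1) (hU' : Uᴴ * U = 1) (x : m → ℝ)
    (φ : ℝ → ℝ) : (hermFC φ (specMat U x)).trace.re = ∑ i, φ (x i) := by
  have hf := specMat_isHermitian U x
  have h1 := Matrix.mem_unitaryGroup_iff.1 hf.eigenvectorUnitary.2
  have h2 := Matrix.mem_unitaryGroup_iff'.1 hf.eigenvectorUnitary.2
  rw [star_eq_conjTranspose] at h1 h2
  have e : specMat U x = specMat (hf.eigenvectorUnitary : Matrix m m ℂ) hf.eigenvalues := by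
    conv_lhs => rw [hf.spectral_theorem]
    simp [specMat, Unitary.conjStarAlgAut_apply, star_eq_conjTranspose, Function.comp_def]
  rw [sum_comp_eq_of_specMat_eq hU hU' h1 h2 e φ, hermFC, dif_pos hf]
  exact trace_specMat h2 _

lemma trace_mpow_specMat {U : Matrix m m ℂ} (hU : U * Uᴴ = 1) (hU' : Uᴴ * U = 1) (x : m → ℝ)
    (p : ℝ) : (mpow (specMat U x) p).trace.re = ∑ i, x i ^ p :=
  trace_hermFC_specMat hU hU' x _

lemma exists_specMat_ge {f : Matrix m m ℂ} {ε : ℝ} (h : (f - (ε : ℂ) • 1).PosSemidef) :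
    ∃ (U : Matrix m m ℂ) (x : m → ℝ), U * Uᴴ = 1 ∧ Uᴴ * U = 1 ∧ f = specMat U x ∧
      ∀ i, ε ≤ x i := by
  have hf : f.IsHermitian := by
    have h1 : ((ε : ℂ) • (1 : Matrix m m ℂ)).IsHermitian := by
      rw [← specMat_const (U := 1) (by simp)]; exact specMat_isHermitian _ _
    simpa using h.1.add h1
  obtain ⟨U, x, hU, hU', rfl⟩ := exists_specMat hf
  refine ⟨U, x, hU, hU', rfl, fun i => ?_⟩
  rw [← specMat_const hU, sub_eq_add_neg] at h
  have e : -specMat U (fun _ => ε) = specMat U (fun _ => -ε) := by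
    rw [specMat_const hU, specMat_const hU]; push_cast; module
  rw [e, ← specMat_add] at h
  have := nonneg_of_specMat_posSemidef hU' h i
  linarith

lemma abs_diag_conj_le {V : Matrix m m ℂ} (hV : Vᴴ * V = 1) (D : Matrix m m ℂ) (j : m) :
    |((Vᴴ * D * V) j j).re| ≤ ∑ a, ∑ b, ‖D a b‖ := by
  have h1 : ∀ a, ‖V a j‖ ≤ 1 := by
    intro a
    have := Finset.single_le_sum (f := fun a => Complex.normSq (V a j))
      (fun a _ => Complex.normSq_nonneg _) (Finset.mem_univ a)
    rw [col_normSq_unitary hV] at this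
    rw [Complex.normSq_eq_norm_sq] at this
    nlinarith [norm_nonneg (V a j)]
  refine (Complex.abs_re_le_norm _).trans ?_
  rw [Matrix.mul_assoc, Matrix.mul_apply]
  refine (norm_sum_le _ _).trans (Finset.sum_le_sum fun a _ => ?_)
  rw [norm_mul, conjTranspose_apply, norm_star, Matrix.mul_apply]
  calc _ ≤ 1 * ∑ b, ‖D a b * V b j‖ := by
        gcongr
        · exact h1 a
        · exact norm_sum_le _ _
    _ ≤ _ := by
        rw [one_mul]
        refine Finset.sum_le_sum fun b _ => ?_
        rw [norm_mul]
        exact mul_le_of_le_one_right (norm_nonneg _) (h1 b)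

/-- Lower semicontinuity of the trace of a power, in quantitative form. -/
lemma trace_mpow_ge {U V : Matrix m m ℂ} (hU : U * Uᴴ = 1) (hU' : Uᴴ * U = 1) (hV : V * Vᴴ = 1)
    (hV' : Vᴴ * V = 1) {a b : m → ℝ} {ε : ℝ} (hε : 0 < ε) (ha : ∀ i, ε ≤ a i) (hb : ∀ i, ε ≤ b i)
    {p : ℝ} (hp0 : 0 < p) (hp1 : p < 1) :
    ∑ i, a i ^ p - p * ε ^ (p - 1) * (Fintype.card m * ∑ i, ∑ j,
      ‖(specMat U a - specMat V b) i j‖) ≤ ∑ j, b j ^ p := by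
  have h := klein_rpow hV hV' hU hU' (fun i => hε.trans_le (hb i)) (fun i => hε.trans_le (ha i))
    hp0 hp1
  set N := ∑ i, ∑ j, ‖(specMat U a - specMat V b) i j‖ with hN
  have h2 : ∀ j, (1 - p) * b j ^ p + p * b j ^ (p - 1) * ((Vᴴ * specMat U a * V) j j).re ≤
      b j ^ p + p * ε ^ (p - 1) * N := by
    intro j
    have e : ((Vᴴ * specMat U a * V) j j).re =
        b j + ((Vᴴ * (specMat U a - specMat V b) * V) j j).re := by
      rw [Matrix.mul_sub, Matrix.sub_mul, specMat_coeff hV']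
      simp
    have hbj : 0 < b j := hε.trans_le (hb j)
    have e2 : b j ^ (p - 1) * b j = b j ^ p := by
      rw [Real.rpow_sub_one hbj.ne']; field_simp
    have h3 : b j ^ (p - 1) ≤ ε ^ (p - 1) :=
      Real.rpow_le_rpow_of_nonpos hε (hb j) (by linarith)
    have h4 := (abs_le.1 (abs_diag_conj_le hV' (specMat U a - specMat V b) j)).2
    have h5 : b j ^ (p - 1) * ((Vᴴ * (specMat U a - specMat V b) * V) j j).re ≤
        ε ^ (p - 1) * N := by
      calc _ ≤ b j ^ (p - 1) * N := by gcongr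
        _ ≤ _ := by
          have : 0 ≤ N := by positivity
          gcongr
    rw [e]
    have := mul_le_mul_of_nonneg_left h5 hp0.le
    linear_combination this + p * e2
  have h6 := h.trans (Finset.sum_le_sum fun j _ => h2 j)
  rw [Finset.sum_add_distrib, Finset.sum_const, Finset.card_univ, nsmul_eq_mul] at h6
  linarith

end TracePower

section Flow

variable {m K : Type*} [Fintype m] [DecidableEq m] [Nonempty m] [Fintype K]

lemma rpow_tangent_self {m : Type*} [Fintype m] {a : m → ℝ} (ha : ∀ i, 0 < a i) (p : ℝ) :
    ∑ i, ((1 - p) * a i ^ p + p * a i ^ (p - 1) * a i) = ∑ i, a i ^ p := by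
  refine Finset.sum_congr rfl fun i _ => ?_
  rw [Real.rpow_sub_one (ha i).ne']
  have := (ha i).ne'
  field_simp
  ring

lemma hasDerivAt_rpow_tangent {m : Type*} [Fintype m] {a : m → ℝ} (ha : ∀ i, 0 < a i)
    {μ : ℝ → m → ℝ} {μ' : m → ℝ} {p : ℝ → ℝ} {p' t : ℝ} (hp : HasDerivAt p p' t)
    (hμ : ∀ i, HasDerivAt (fun s => μ s i) (μ' i) t) (hμt : ∀ i, μ t i = a i) :
    HasDerivAt (fun s => ∑ i, ((1 - p s) * a i ^ p s + p s * a i ^ (p s - 1) * μ s i))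
      (∑ i, (p' * (a i ^ p t * Real.log (a i)) + p t * (a i ^ (p t - 1) * μ' i))) t := by
  refine HasDerivAt.fun_sum fun i _ => ?_
  have h1 : HasDerivAt (fun s => a i ^ p s) (Real.log (a i) * p' * a i ^ p t) t :=
    hp.const_rpow (ha i)
  have h2 : HasDerivAt (fun s => a i ^ (p s - 1)) (Real.log (a i) * p' * a i ^ (p t - 1)) t :=
    (hp.sub_const 1).const_rpow (ha i)
  have h3 := ((hp.const_sub 1).mul h1).add ((hp.mul h2).mul (hμ i))
  refine h3.congr_deriv ?_
  have e2 : a i ^ (p t - 1) * a i = a i ^ p t := by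
    rw [Real.rpow_sub_one (ha i).ne']; have := (ha i).ne'; field_simp
  simp only [Pi.mul_apply, hμt]
  linear_combination (p' + p t * Real.log (a i) * p') * e2

/-- The tangent to `log (Tr F ^ p) / p` used in the monotonicity argument, with its derivative. -/
lemma hasDerivAt_log_tangent {m : Type*} [Fintype m] [Nonempty m] {a : m → ℝ} (ha : ∀ i, 0 < a i)
    {μ : ℝ → m → ℝ} {μ' : m → ℝ}
    {p : ℝ → ℝ} {p' t : ℝ} (hp : HasDerivAt p p' t) (hpt : 0 < p t)
    (hμ : ∀ i, HasDerivAt (fun s => μ s i) (μ' i) t) (hμt : ∀ i, μ t i = a i) :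
    HasDerivAt (fun s => 1 / p s * Real.log ((∑ i, ((1 - p s) * a i ^ p s +
      p s * a i ^ (p s - 1) * μ s i)) / Fintype.card m))
      (1 / (p t ^ 2 * ∑ i, a i ^ p t) * (p' * (p t * ∑ i, a i ^ p t * Real.log (a i) -
        (∑ i, a i ^ p t) * Real.log (∑ i, a i ^ p t) +
        (∑ i, a i ^ p t) * Real.log (Fintype.card m)) +
          p t ^ 2 * ∑ i, a i ^ (p t - 1) * μ' i)) t := by
  have hd : (0 : ℝ) < Fintype.card m := by exact_mod_cast Fintype.card_pos
  have hS : 0 < ∑ i, a i ^ p t :=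
    Finset.sum_pos (fun i _ => Real.rpow_pos_of_pos (ha i) _) Finset.univ_nonempty
  have hR0 : ∑ i, ((1 - p t) * a i ^ p t + p t * a i ^ (p t - 1) * μ t i) = ∑ i, a i ^ p t := by
    simp only [hμt]; exact rpow_tangent_self ha _
  have hlog := ((hasDerivAt_rpow_tangent ha hp hμ hμt).div_const (Fintype.card m : ℝ)).log
    (by rw [hR0]; positivity)
  have hinv : HasDerivAt (fun s => 1 / p s) (-p' / p t ^ 2) t := by
    simp only [one_div]; exact hp.inv hpt.ne'
  refine (hinv.mul hlog).congr_deriv ?_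
  simp only [hR0]
  rw [Real.log_div hS.ne' hd.ne', Finset.sum_add_distrib, ← Finset.mul_sum, ← Finset.mul_sum]
  field_simp
  ring

lemma hasDerivAt_diag_conj {m : Type*} [Fintype m] {F : ℝ → Matrix m m ℂ} {F' : Matrix m m ℂ}
    {t : ℝ} (hF : ∀ i j, HasDerivAt (fun s => F s i j) (F' i j) t) (U : Matrix m m ℂ) (i : m) :
    HasDerivAt (fun s => ((Uᴴ * F s * U) i i).re) ((Uᴴ * F' * U) i i).re t := by
  have h : HasDerivAt (fun s => (Uᴴ * F s * U) i i) ((Uᴴ * F' * U) i i) t := by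
    simp only [Matrix.mul_apply]
    exact HasDerivAt.fun_sum fun j _ => (HasDerivAt.fun_sum fun k _ =>
      (hF k j).const_mul _).mul_const _
  exact Complex.reCLM.hasFDerivAt.comp_hasDerivAt t h

lemma trace_specMat_mul_eq {m : Type*} [Fintype m] [DecidableEq m] (U A : Matrix m m ℂ)
    (x : m → ℝ) : (specMat U x * A).trace.re = ∑ i, x i * ((Uᴴ * A * U) i i).re := by
  have : (specMat U x * A).trace = (diagonal (fun i => (x i : ℂ)) * (Uᴴ * A * U)).trace := by
    simp only [specMat, Matrix.mul_assoc]
    rw [Matrix.trace_mul_comm U]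
    simp only [Matrix.mul_assoc]
  rw [this, Matrix.trace]
  simp [diagonal_mul]

/-- Reverse hypercontractivity along a flow, from the logarithmic Sobolev inequality. -/
theorem log_trace_mpow_flow {E : K → Matrix m m ℂ → Matrix m m ℂ} (hLS : LogSob E)
    (hE : ∀ k, IsMix (E k)) (hR : ∀ k, IsReversible (E k)) {F : ℝ → Matrix m m ℂ} {γ ε : ℝ}
    (hγ0 : 0 < γ) (hγ1 : γ ≤ 1) (hε : 0 < ε)
    (hF : ∀ s ∈ Set.Icc γ 1, (F s - (ε : ℂ) • 1).PosSemidef)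
    (hF' : ∀ s ∈ Set.Icc γ 1, ∀ i j, HasDerivAt (fun s => F s i j)
      ((((s⁻¹ : ℝ) : ℂ) • ∑ k, (F s - E k (F s))) i j) s)
    {p₀ : ℝ} (hp0 : 0 < p₀) (hp1 : p₀ < 1) :
    1 / (1 - γ ^ 2 * (1 - p₀)) * Real.log (ntrace (mpow (F 1) (1 - γ ^ 2 * (1 - p₀)))) ≤
      1 / p₀ * Real.log (ntrace (mpow (F γ) p₀)) := by
  set c := γ ^ 2 * (1 - p₀) with hc
  have hc0 : 0 < c := by have : 0 < 1 - p₀ := by linarith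
                         positivity
  set p : ℝ → ℝ := fun s => 1 - c / s ^ 2 with hp
  have hd : (0 : ℝ) < Fintype.card m := by exact_mod_cast Fintype.card_pos
  have hpos : ∀ s ∈ Set.Icc γ 1, 0 < s := fun s hs => hγ0.trans_le hs.1
  have hppos : ∀ s ∈ Set.Icc γ 1, 0 < p s := by
    intro s hs
    have h1 := hpos s hs
    have : c / s ^ 2 < 1 := by
      rw [div_lt_one (by positivity), hc]
      have h2 : γ ^ 2 ≤ s ^ 2 := pow_le_pow_left₀ hγ0.le hs.1 2
      nlinarith [sq_pos_of_pos h1, sq_pos_of_pos hγ0]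
    simp only [hp]; linarith
  have hplt : ∀ s ∈ Set.Icc γ 1, p s < 1 := by
    intro s hs
    have h1 := hpos s hs
    have : 0 < c / s ^ 2 := by positivity
    simp only [hp]; linarith
  have hpder : ∀ s ∈ Set.Icc γ 1, HasDerivAt p (2 * c / s ^ 3) s := by
    intro s hs
    have h1 := (hpos s hs).ne'
    have h2 := (((hasDerivAt_pow 2 s).inv (pow_ne_zero 2 h1)).const_mul c).const_sub 1
    refine (h2.congr_of_eventuallyEq (Filter.Eventually.of_forall fun x => ?_)).congr_deriv ?_
    · simp [hp, div_eq_mul_inv]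
    · field_simp
      norm_num
      ring
  set h : ℝ → ℝ := fun s => 1 / p s * Real.log ((mpow (F s) (p s)).trace.re / Fintype.card m)
    with hh
  have upper : ∀ t ∈ Set.Icc γ 1, ∀ (U : Matrix m m ℂ) (a : m → ℝ), U * Uᴴ = 1 → Uᴴ * U = 1 →
      (∀ i, ε ≤ a i) → F t = specMat U a → ∀ s ∈ Set.Icc γ 1,
      0 < (mpow (F s) (p s)).trace.re ∧ (mpow (F s) (p s)).trace.re ≤
        ∑ i, ((1 - p s) * a i ^ p s + p s * a i ^ (p s - 1) * ((Uᴴ * F s * U) i i).re) := by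
    intro t ht U a hU hU' ha hFt s hs
    obtain ⟨V, b, hV, hV', hFs, hb⟩ := exists_specMat_ge (hF s hs)
    rw [hFs, trace_mpow_specMat hV hV']
    exact ⟨Finset.sum_pos (fun i _ => Real.rpow_pos_of_pos (hε.trans_le (hb i)) _)
      Finset.univ_nonempty, klein_rpow hU hU' hV hV' (fun i => hε.trans_le (ha i))
      (fun i => hε.trans_le (hb i)) (hppos s hs) (hplt s hs)⟩
  have hμt : ∀ t (U : Matrix m m ℂ) (a : m → ℝ), Uᴴ * U = 1 → F t = specMat U a →
      ∀ i, ((Uᴴ * F t * U) i i).re = a i := by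
    intro t U a hU' hFt i
    rw [hFt, specMat_coeff hU']; simp
  have hcont : ContinuousOn h (Set.Icc γ 1) := by
    intro t ht
    obtain ⟨U, a, hU, hU', hFt, ha⟩ := exists_specMat_ge (hF t ht)
    have ha0 : ∀ i, 0 < a i := fun i => hε.trans_le (ha i)
    have hpc : ContinuousAt p t := (hpder t ht).continuousAt
    have hS : ContinuousWithinAt (fun s => (mpow (F s) (p s)).trace.re) (Set.Icc γ 1) t := by
      have ht0 : (mpow (F t) (p t)).trace.re = ∑ i, a i ^ p t := by
        rw [hFt, trace_mpow_specMat hU hU']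
      have hup := ((hasDerivAt_rpow_tangent ha0 (hpder t ht)
        (hasDerivAt_diag_conj (hF' t ht) U) (hμt t U a hU' hFt)).continuousAt).tendsto
      simp only [hμt t U a hU' hFt, rpow_tangent_self ha0] at hup
      have hlo : ContinuousAt (fun s => ∑ i, a i ^ p s - p s * ε ^ (p s - 1) * (Fintype.card m *
          ∑ i, ∑ j, ‖(F t - F s) i j‖)) t := by
        have h1 : ∀ i, ContinuousAt (fun s => a i ^ p s) t := fun i =>
          ContinuousAt.rpow continuousAt_const hpc (Or.inl (ha0 i).ne')
        have h2 : ContinuousAt (fun s => ε ^ (p s - 1)) t :=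
          ContinuousAt.rpow continuousAt_const (hpc.sub continuousAt_const) (Or.inl hε.ne')
        have h3 : ∀ i j, ContinuousAt (fun s => F s i j) t := fun i j =>
          (hF' t ht i j).continuousAt
        simp only [Matrix.sub_apply]
        fun_prop
      have hlo' := hlo.tendsto
      simp only [sub_self, Matrix.zero_apply, norm_zero, Finset.sum_const_zero, mul_zero,
        sub_zero] at hlo'
      rw [ContinuousWithinAt, ht0]
      refine tendsto_of_tendsto_of_tendsto_of_le_of_le'
        (hlo'.mono_left nhdsWithin_le_nhds) (hup.mono_left nhdsWithin_le_nhds) ?_ ?_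
      · filter_upwards [self_mem_nhdsWithin] with s hs
        obtain ⟨V, b, hV, hV', hFs, hb⟩ := exists_specMat_ge (hF s hs)
        rw [hFs, trace_mpow_specMat hV hV', hFt]
        exact trace_mpow_ge hU hU' hV hV' hε ha hb (hppos s hs) (hplt s hs)
      · filter_upwards [self_mem_nhdsWithin] with s hs
        exact (upper t ht U a hU hU' ha hFt s hs).2
    have hpos' := (upper t ht U a hU hU' ha hFt t ht).1
    refine ContinuousWithinAt.mul ?_ ?_
    · exact (continuousAt_const.div hpc (hppos t ht).ne').continuousWithinAt
    · exact (hS.div_const _).log (by positivity)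
  have hbound : ∀ t ∈ Set.Ico γ 1, ∀ r, (0 : ℝ) < r → ∃ᶠ z in nhdsWithin t (Set.Ioi t),
      slope h t z < r := by
    intro t ht' r hr
    have ht : t ∈ Set.Icc γ 1 := ⟨ht'.1, ht'.2.le⟩
    have ht0 := hpos t ht
    obtain ⟨U, a, hU, hU', hFt, ha⟩ := exists_specMat_ge (hF t ht)
    have ha0 : ∀ i, 0 < a i := fun i => hε.trans_le (ha i)
    have hder := hasDerivAt_log_tangent ha0 (hpder t ht) (hppos t ht)
        (hasDerivAt_diag_conj (hF' t ht) U) (hμt t U a hU' hFt)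
    set H := fun s => 1 / p s * Real.log ((∑ i, ((1 - p s) * a i ^ p s +
      p s * a i ^ (p s - 1) * ((Uᴴ * F s * U) i i).re)) / Fintype.card m) with hH
    have hHt : H t = h t := by
      simp only [hH, hh, hμt t U a hU' hFt, rpow_tangent_self ha0]
      rw [hFt, trace_mpow_specMat hU hU']
    have hle : ∀ s ∈ Set.Icc γ 1, h s ≤ H s := by
      intro s hs
      obtain ⟨h1, h2⟩ := upper t ht U a hU hU' ha hFt s hs
      have := hppos s hs
      simp only [hH, hh]
      gcongr
    have hneg : 1 / (p t ^ 2 * ∑ i, a i ^ p t) * (2 * c / t ^ 3 * (p t * ∑ i, a i ^ p t *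
        Real.log (a i) - (∑ i, a i ^ p t) * Real.log (∑ i, a i ^ p t) +
        (∑ i, a i ^ p t) * Real.log (Fintype.card m)) + p t ^ 2 * ∑ i, a i ^ (p t - 1) *
        ((Uᴴ * (((t⁻¹ : ℝ) : ℂ) • ∑ k, (F t - E k (F t))) * U) i i).re) ≤ 0 := by
      have hls := hLS.rpow hE hR hU hU' ha0 (hppos t ht) (hplt t ht)
      rw [← trace_specMat_mul_eq]
      rw [← hFt] at hls
      have e : (specMat U (fun i => a i ^ (p t - 1)) * (((t⁻¹ : ℝ) : ℂ) •
          ∑ k, (F t - E k (F t)))).trace.re = -(t⁻¹ * (specMat U (fun i => a i ^ (p t - 1)) *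
          ∑ k, (E k (F t) - F t)).trace.re) := by
        have : ∑ k, (F t - E k (F t)) = -∑ k, (E k (F t) - F t) := by
          rw [← Finset.sum_neg_distrib]; simp
        rw [this, Matrix.mul_smul, Matrix.mul_neg, Matrix.trace_smul, Matrix.trace_neg, smul_neg,
          Complex.neg_re, smul_eq_mul, Complex.re_ofReal_mul]
      rw [e]
      set T := (specMat U (fun i => a i ^ (p t - 1)) * ∑ k, (E k (F t) - F t)).trace.re
      have hS : 0 < ∑ i, a i ^ p t :=
        Finset.sum_pos (fun i _ => Real.rpow_pos_of_pos (ha0 i) _) Finset.univ_nonempty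
      refine mul_nonpos_of_nonneg_of_nonpos (by positivity) ?_
      have h3 := mul_le_mul_of_nonneg_left hls (show 0 ≤ 2 * c / t ^ 3 by positivity)
      have e2 : 2 * c / t ^ 3 * (p t ^ 2 / (2 * (1 - p t)) * T) = p t ^ 2 * (t⁻¹ * T) := by
        have : 1 - p t = c / t ^ 2 := by simp [hp]
        rw [this]
        field_simp
      linarith
    have hlim := (hasDerivAt_iff_tendsto_slope.1 hder).mono_left
      (nhdsWithin_mono t fun z (hz : z ∈ Set.Ioi t) => ne_of_gt hz)
    refine Filter.Eventually.frequently ?_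
    filter_upwards [hlim.eventually_lt_const (hneg.trans_lt hr),
      Ioo_mem_nhdsGT ht'.2] with z hz hz2
    refine lt_of_le_of_lt ?_ hz
    rw [slope_def_field, slope_def_field, hHt]
    have := hle z ⟨ht.1.trans hz2.1.le, hz2.2.le⟩
    have h5 : 0 < z - t := sub_pos.2 hz2.1
    gcongr
  have hfin := image_le_of_liminf_slope_right_le_deriv_boundary hcont (B := fun _ => h γ)
    (B' := fun _ => 0) le_rfl continuousOn_const (fun x _ => hasDerivWithinAt_const _ _ _) hbound
    (Set.right_mem_Icc.2 hγ1)
  have e1 : p 1 = 1 - c := by simp [hp]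
  have e2 : p γ = p₀ := by simp only [hp, hc]; field_simp; ring
  simpa only [hh, e1, e2, ntrace] using hfin

end Flow

section GeometricMean

lemma tendsto_log_powerMean {m : Type*} [Fintype m] [Nonempty m] {x : m → ℝ} (hx : ∀ i, 0 < x i) :
    Filter.Tendsto (fun p : ℝ => 1 / p * Real.log ((∑ i, x i ^ p) / Fintype.card m))
      (nhdsWithin 0 (Set.Ioi 0)) (nhds ((∑ i, Real.log (x i)) / Fintype.card m)) := by
  have hd : (Fintype.card m : ℝ) ≠ 0 := by exact_mod_cast Fintype.card_ne_zero
  have h0 : (∑ i, x i ^ (0 : ℝ)) / Fintype.card m = 1 := by simp [hd]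
  have h1 : HasDerivAt (fun p : ℝ => (∑ i, x i ^ p) / Fintype.card m)
      ((∑ i, Real.log (x i)) / Fintype.card m) 0 := by
    refine HasDerivAt.div_const (HasDerivAt.fun_sum fun i _ => ?_) _
    simpa using (hasDerivAt_id (0 : ℝ)).const_rpow (hx i)
  have h2 := h1.log (by rw [h0]; exact one_ne_zero)
  rw [h0, div_one] at h2
  have h3 := (hasDerivAt_iff_tendsto_slope.1 h2).mono_left
    (nhdsWithin_mono 0 fun z (hz : z ∈ Set.Ioi 0) => ne_of_gt hz)
  refine h3.congr fun p => ?_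
  rw [slope_def_field, h0, Real.log_one, sub_zero, sub_zero, div_eq_inv_mul, one_div]

variable {m : Type*} [Fintype m] [DecidableEq m]

/-- Traces of positive operators dominate the product of their Fuglede–Kadison determinants. -/
lemma exp_log_add_log_le_ntrace_mul [Nonempty m] {f g : Matrix m m ℂ} {ε : ℝ} (hε : 0 < ε)
    (hf : (f - (ε : ℂ) • 1).PosSemidef) (hg : (g - (ε : ℂ) • 1).PosSemidef) :
    Real.exp (ntrace (hermFC Real.log f) + ntrace (hermFC Real.log g)) ≤ ntrace (f * g) := by
  obtain ⟨U, x, hU, hU', rfl, hx⟩ := exists_specMat_ge hf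
  obtain ⟨V, y, hV, hV', rfl, hy⟩ := exists_specMat_ge hg
  have hd : (0 : ℝ) < Fintype.card m := by exact_mod_cast Fintype.card_pos
  have ht := trace_specMat_mul U V 1 x y
  simp only [Matrix.mul_one, conjTranspose_one] at ht
  simp only [ntrace, ht, trace_hermFC_specMat hU hU', trace_hermFC_specMat hV hV']
  set L := (∑ i, Real.log (x i)) / Fintype.card m + (∑ i, Real.log (y i)) / Fintype.card m with hL
  have u1 : (Uᴴ * V) * (Uᴴ * V)ᴴ = 1 := by
    simp only [conjTranspose_mul, conjTranspose_conjTranspose, Matrix.mul_assoc]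
    rw [← Matrix.mul_assoc V, hV, Matrix.one_mul, hU']
  have u2 : (Uᴴ * V)ᴴ * (Uᴴ * V) = 1 := by
    simp only [conjTranspose_mul, conjTranspose_conjTranspose, Matrix.mul_assoc]
    rw [← Matrix.mul_assoc U, hU, Matrix.one_mul, hV']
  have hrow := row_normSq_unitary u1
  have hcol := col_normSq_unitary u2
  rw [le_div_iff₀ hd]
  have hpt : ∀ i j, Real.exp L * (1 + (Real.log (x i) + Real.log (y j)) - L) *
      Complex.normSq ((Uᴴ * V) i j) ≤ x i * y j * Complex.normSq ((Uᴴ * V) i j) := by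
    intro i j
    refine mul_le_mul_of_nonneg_right ?_ (Complex.normSq_nonneg _)
    have h1 := Real.add_one_le_exp (Real.log (x i) + Real.log (y j) - L)
    have h2 : Real.exp L * Real.exp (Real.log (x i) + Real.log (y j) - L) = x i * y j := by
      rw [← Real.exp_add, add_sub_cancel, Real.exp_add, Real.exp_log (hε.trans_le (hx i)),
        Real.exp_log (hε.trans_le (hy j))]
    rw [← h2]
    refine mul_le_mul_of_nonneg_left ?_ (Real.exp_pos _).le
    linarith
  refine le_trans (le_of_eq ?_) (Finset.sum_le_sum fun i _ => Finset.sum_le_sum fun j _ => hpt i j)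
  have e : ∀ i j, Real.exp L * (1 + (Real.log (x i) + Real.log (y j)) - L) *
      Complex.normSq ((Uᴴ * V) i j) = Real.exp L * (1 - L) * Complex.normSq ((Uᴴ * V) i j) +
        Real.exp L * (Real.log (x i) * Complex.normSq ((Uᴴ * V) i j)) +
        Real.exp L * (Real.log (y j) * Complex.normSq ((Uᴴ * V) i j)) := fun i j => by ring
  have e1 : ∑ i, ∑ j, Real.log (y j) * Complex.normSq ((Uᴴ * V) i j) = ∑ j, Real.log (y j) := by
    rw [Finset.sum_comm]; simp [← Finset.mul_sum, hcol]
  simp only [e, Finset.sum_add_distrib, ← Finset.mul_sum, hrow, e1]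
  simp only [Finset.sum_const, Finset.card_univ, nsmul_eq_mul, mul_one, hL]
  field_simp
  ring

lemma ntrace_le_ntrace_mpow_add {f : Matrix m m ℂ} (h0 : f.PosSemidef) (h1 : (1 - f).PosSemidef)
    {ε q : ℝ} (hε : 0 ≤ ε) (hq0 : 0 < q) (hq1 : q < 1) :
    ntrace f ≤ ntrace (mpow (f + (ε : ℂ) • 1) q) := by
  obtain ⟨U, x, hU, hU', rfl⟩ := exists_specMat h0.1
  have hx0 := nonneg_of_specMat_posSemidef hU' h0
  have hx1 : ∀ i, 0 ≤ 1 + -x i := by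
    have e : (1 : Matrix m m ℂ) - specMat U x = specMat U (fun i => 1 + -x i) := by
      have h2 : specMat U x + specMat U (fun i => 1 + -x i) = 1 := by
        rw [← specMat_add]; simpa using specMat_const hU 1
      rw [← h2]; abel
    exact nonneg_of_specMat_posSemidef hU' (e ▸ h1)
  rw [← specMat_const hU, ← specMat_add]
  unfold ntrace
  rw [trace_mpow_specMat hU hU', trace_specMat hU']
  gcongr with i
  calc x i ≤ x i ^ q := by
        have := Real.rpow_le_rpow_of_exponent_ge' (hx0 i) (by linarith [hx1 i]) hq0.le hq1.le
        simpa using this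
    _ ≤ _ := by
        have := hx0 i
        gcongr; linarith

end GeometricMean

section Mixing

variable {n : ℕ}

lemma depolChannel_add (γ : ℝ) (f g : Matrix (Fin n → Fin 2) (Fin n → Fin 2) ℂ) :
    depolChannel γ (f + g) = depolChannel γ f + depolChannel γ g :=
  depolList_add γ _ f g

lemma depolChannel_smul (γ : ℝ) (c : ℂ) (f : Matrix (Fin n → Fin 2) (Fin n → Fin 2) ℂ) :
    depolChannel γ (c • f) = c • depolChannel γ f :=
  depolList_smul γ _ c f

lemma depolChannel_one (γ : ℝ) :
    depolChannel γ (1 : Matrix (Fin n → Fin 2) (Fin n → Fin 2) ℂ) = 1 :=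
  depolList_one γ _

lemma depolChannel_sub_posSemidef {γ ε : ℝ} (h0 : 0 ≤ γ) (h1 : γ ≤ 1)
    {f : Matrix (Fin n → Fin 2) (Fin n → Fin 2) ℂ} (hf : (f - (ε : ℂ) • 1).PosSemidef) :
    (depolChannel γ f - (ε : ℂ) • 1).PosSemidef := by
  have e : depolChannel γ f - (ε : ℂ) • 1 = depolChannel γ (f - (ε : ℂ) • 1) := by
    have h2 : depolChannel γ (f - (ε : ℂ) • 1) + depolChannel γ ((ε : ℂ) • 1) =
        depolChannel γ f := by
      rw [← depolChannel_add, sub_add_cancel]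
    rw [← h2, depolChannel_smul, depolChannel_one, add_sub_cancel_right]
  rw [e]
  exact depolList_posSemidef h0 h1 _ hf

lemma log_le_ntrace_log_depolChannel {g : Matrix (Fin n → Fin 2) (Fin n → Fin 2) ℂ} {ε γ σ : ℝ}
    (hε : 0 < ε) (hg : (g - (ε : ℂ) • 1).PosSemidef) (hγ0 : 0 < γ) (hγ1 : γ < 1) (hσ : 0 < σ)
    (h : ∀ q : ℝ, 0 < q → q < 1 → σ ≤ ntrace (mpow g q)) :
    1 / (1 - γ ^ 2) * Real.log σ ≤ ntrace (hermFC Real.log (depolChannel γ g)) := by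
  obtain ⟨U, x, hU, hU', hx, hxε⟩ :=
    exists_specMat_ge (depolChannel_sub_posSemidef hγ0.le hγ1.le hg)
  have hone : depolChannel 1 g = g := depolList_one_left _ g
  have hlim : Filter.Tendsto (fun p : ℝ => 1 / p * Real.log (ntrace (mpow (depolChannel γ g) p)))
      (nhdsWithin 0 (Set.Ioi 0)) (nhds (ntrace (hermFC Real.log (depolChannel γ g)))) := by
    simp only [ntrace, hx, trace_mpow_specMat hU hU', trace_hermFC_specMat hU hU']
    exact tendsto_log_powerMean fun i => hε.trans_le (hxε i)
  have hγ2 : γ ^ 2 < 1 := by nlinarith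
  have hlim2 : Filter.Tendsto (fun p : ℝ => 1 / (1 - γ ^ 2 * (1 - p)) * Real.log σ)
      (nhdsWithin 0 (Set.Ioi 0)) (nhds (1 / (1 - γ ^ 2) * Real.log σ)) := by
    have : ContinuousAt (fun p : ℝ => 1 / (1 - γ ^ 2 * (1 - p)) * Real.log σ) 0 := by
      refine ContinuousAt.mul (ContinuousAt.div continuousAt_const (by fun_prop) ?_)
        continuousAt_const
      simp only [sub_zero, mul_one]; linarith
    have := this.tendsto
    simp only [sub_zero, mul_one] at this
    exact this.mono_left nhdsWithin_le_nhds
  refine le_of_tendsto_of_tendsto hlim2 hlim ?_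
  filter_upwards [Ioo_mem_nhdsGT (zero_lt_one (α := ℝ))] with p hp
  have hfl := log_trace_mpow_flow (logSob_depolAt n) (fun k => isMix_depolAt k)
    (fun k => isReversible_depolAt_zero k) (F := fun s => depolChannel s g) hγ0 hγ1.le hε
    (fun s hs => depolChannel_sub_posSemidef (hγ0.le.trans hs.1) hs.2 hg)
    (fun s hs i j => hasDerivAt_depolChannel g (hγ0.trans_le hs.1).ne' i j) hp.1 hp.2
  simp only [hone] at hfl
  refine le_trans ?_ hfl
  have hp1 : 0 < 1 - p := by linarith [hp.2]
  have hq1 : γ ^ 2 * (1 - p) < 1 := by nlinarith [hp.1, sq_nonneg γ]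
  have hq0 : 0 < γ ^ 2 * (1 - p) := by positivity
  have hq : 0 < 1 - γ ^ 2 * (1 - p) := by linarith
  have := h (1 - γ ^ 2 * (1 - p)) hq (by linarith)
  gcongr

lemma ntrace_mul_depolChannel (γ δ : ℝ) (f g : Matrix (Fin n → Fin 2) (Fin n → Fin 2) ℂ) :
    ntrace (f * depolChannel (γ * δ) g) = ntrace (depolChannel γ f * depolChannel δ g) := by
  have h1 : depolChannel (γ * δ) g = depolChannel γ (depolChannel δ g) :=
    (depolList_depolList γ δ _ g).symm
  have h2 : (f * depolChannel γ (depolChannel δ g)).trace =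
      (depolChannel γ f * depolChannel δ g).trace := isReversible_depolList γ _ f _
  rw [ntrace, ntrace, h1, h2]

/-- Two-function mixing bound at noise level `γ * δ`. -/
lemma exp_le_ntrace_mul_depolChannel {M P : Matrix (Fin n → Fin 2) (Fin n → Fin 2) ℂ}
    (hM0 : M.PosSemidef) (hM1 : (1 - M).PosSemidef) (hP0 : P.PosSemidef)
    (hP1 : (1 - P).PosSemidef) {γ δ s t : ℝ} (hγ0 : 0 < γ) (hγ1 : γ < 1) (hδ0 : 0 < δ)
    (hδ1 : δ < 1) (hs : 0 < s) (ht : 0 < t) (hM : s ≤ ntrace M) (hP : t ≤ ntrace P) :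
    Real.exp (1 / (1 - γ ^ 2) * Real.log s + 1 / (1 - δ ^ 2) * Real.log t) ≤
      ntrace (M * depolChannel (γ * δ) P) := by
  have key : ∀ ε : ℝ, 0 < ε →
      Real.exp (1 / (1 - γ ^ 2) * Real.log s + 1 / (1 - δ ^ 2) * Real.log t) ≤
        ntrace ((M + (ε : ℂ) • 1) * depolChannel (γ * δ) (P + (ε : ℂ) • 1)) := by
    intro ε hε
    have h1 : (M + (ε : ℂ) • 1 - (ε : ℂ) • 1).PosSemidef := by simpa using hM0
    have h2 : (P + (ε : ℂ) • 1 - (ε : ℂ) • 1).PosSemidef := by simpa using hP0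
    have h3 := log_le_ntrace_log_depolChannel hε h1 hγ0 hγ1 hs fun q hq0 hq1 =>
      hM.trans (ntrace_le_ntrace_mpow_add hM0 hM1 hε.le hq0 hq1)
    have h4 := log_le_ntrace_log_depolChannel hε h2 hδ0 hδ1 ht fun q hq0 hq1 =>
      hP.trans (ntrace_le_ntrace_mpow_add hP0 hP1 hε.le hq0 hq1)
    rw [ntrace_mul_depolChannel]
    refine le_trans (Real.exp_le_exp.2 (add_le_add h3 h4)) ?_
    exact exp_log_add_log_le_ntrace_mul hε (depolChannel_sub_posSemidef hγ0.le hγ1.le h1)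
      (depolChannel_sub_posSemidef hδ0.le hδ1.le h2)
  have hc : Continuous fun ε : ℝ =>
      ntrace ((M + (ε : ℂ) • 1) * depolChannel (γ * δ) (P + (ε : ℂ) • 1)) := by
    simp only [depolChannel_add, depolChannel_smul, depolChannel_one, ntrace]
    refine Continuous.div_const (Complex.continuous_re.comp (Continuous.matrix_trace ?_)) _
    fun_prop
  have hl := (hc.tendsto 0).mono_left (nhdsWithin_le_nhds (s := Set.Ioi 0))
  simp only [Complex.ofReal_zero, zero_smul, add_zero] at hl
  exact ge_of_tendsto hl (by filter_upwards [self_mem_nhdsWithin] with ε hε using key ε hε)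

lemma rpow_le_ntrace_mul_depolChannel_of_pos {M P : Matrix (Fin n → Fin 2) (Fin n → Fin 2) ℂ}
    (hM0 : M.PosSemidef) (hM1 : (1 - M).PosSemidef) (hP0 : P.PosSemidef)
    (hP1 : (1 - P).PosSemidef) {σ a γ : ℝ} (hσ : 0 < σ) (ha : 0 < a) (hγ0 : 0 < γ) (hγ1 : γ < 1)
    (hM : σ ^ (a ^ 2) ≤ ntrace M) (hP : σ ≤ ntrace P) :
    σ ^ ((1 + a ^ 2 + 2 * a * γ) / (1 - γ ^ 2)) ≤ ntrace (M * depolChannel γ P) := by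
  have h1 : 0 < γ * (1 + a * γ) / (a + γ) := by positivity
  have h2 : 0 < γ * (a + γ) / (1 + a * γ) := by positivity
  have hγ2 : 0 < 1 - γ ^ 2 := by nlinarith
  have e1 : 1 - γ * (1 + a * γ) / (a + γ) = a * (1 - γ ^ 2) / (a + γ) := by field_simp; ring
  have e2 : 1 - γ * (a + γ) / (1 + a * γ) = (1 - γ ^ 2) / (1 + a * γ) := by field_simp; ring
  have l1 : γ * (1 + a * γ) / (a + γ) < 1 := by
    have : 0 < a * (1 - γ ^ 2) / (a + γ) := by positivity
    linarith
  have l2 : γ * (a + γ) / (1 + a * γ) < 1 := by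
    have : 0 < (1 - γ ^ 2) / (1 + a * γ) := by positivity
    linarith
  have h := exp_le_ntrace_mul_depolChannel hM0 hM1 hP0 hP1 (Real.sqrt_pos.2 h1)
    ((Real.sqrt_lt' one_pos).2 (by simpa using l1)) (Real.sqrt_pos.2 h2)
    ((Real.sqrt_lt' one_pos).2 (by simpa using l2)) (Real.rpow_pos_of_pos hσ _) hσ hM hP
  rw [← Real.sqrt_mul h1.le, Real.sq_sqrt h1.le, Real.sq_sqrt h2.le, e1, e2,
    Real.log_rpow hσ] at h
  have e3 : γ * (1 + a * γ) / (a + γ) * (γ * (a + γ) / (1 + a * γ)) = γ ^ 2 := by field_simp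
  rw [e3, Real.sqrt_sq hγ0.le] at h
  refine le_trans (le_of_eq ?_) h
  rw [Real.rpow_def_of_pos hσ]
  congr 1
  field_simp
  ring

lemma rpow_le_ntrace_mul_depolChannel {M P : Matrix (Fin n → Fin 2) (Fin n → Fin 2) ℂ}
    (hM0 : M.PosSemidef) (hM1 : (1 - M).PosSemidef) (hP0 : P.PosSemidef)
    (hP1 : (1 - P).PosSemidef) {σ a γ : ℝ} (hσ0 : 0 < σ) (hσ1 : σ ≤ 1) (ha : 0 ≤ a) (hγ0 : 0 ≤ γ)
    (hγ1 : γ < 1) (hM : σ ^ (a ^ 2) ≤ ntrace M) (hP : σ ≤ ntrace P) :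
    σ ^ ((1 + a ^ 2 + 2 * a * γ) / (1 - γ ^ 2)) ≤ ntrace (M * depolChannel γ P) := by
  have hγ2 : 1 - γ ^ 2 ≠ 0 := by nlinarith
  have hl : ContinuousAt (fun η : ℝ => σ ^ ((1 + (a + η) ^ 2 + 2 * (a + η) * (γ + η)) /
      (1 - (γ + η) ^ 2))) 0 := by
    refine ContinuousAt.rpow continuousAt_const ?_ (Or.inl hσ0.ne')
    refine ContinuousAt.div (by fun_prop) (by fun_prop) ?_
    simpa using hγ2
  have hr : Continuous fun η : ℝ => ntrace (M * depolChannel (γ + η) P) := by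
    have hD : ∀ i j, Continuous fun η : ℝ => depolChannel (γ + η) P i j := fun i j =>
      (continuous_depolChannel P i j).comp (continuous_const.add continuous_id)
    have hD' : Continuous fun η : ℝ => depolChannel (γ + η) P := continuous_matrix hD
    unfold ntrace
    exact Continuous.div_const (Complex.continuous_re.comp (Continuous.matrix_trace
      (continuous_const.matrix_mul hD'))) _
  have h1 := hl.tendsto.mono_left (nhdsWithin_le_nhds (s := Set.Ioi 0))
  have h2 := (hr.tendsto 0).mono_left (nhdsWithin_le_nhds (s := Set.Ioi 0))
  simp only [add_zero] at h1 h2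
  refine le_of_tendsto_of_tendsto h1 h2 ?_
  filter_upwards [Ioo_mem_nhdsGT (sub_pos.2 hγ1)] with η hη
  have h3 : σ ^ ((a + η) ^ 2) ≤ σ ^ (a ^ 2) :=
    Real.rpow_le_rpow_of_exponent_ge hσ0 hσ1 (by nlinarith [hη.1])
  exact rpow_le_ntrace_mul_depolChannel_of_pos hM0 hM1 hP0 hP1 hσ0 (by linarith [hη.1])
    (by linarith [hη.1]) (by linarith [hη.2]) (h3.trans hM) hP

end Mixing

/-- Rapid mixing, dimension-fraction form. Here `P` is the orthogonal
projector onto a subspace `S` with `dim S = Tr P = σ 2^n`, and `ρ` is the maximally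
mixed state on `S`. -/
theorem rapid_mixing_fraction
    (n : ℕ) (hn : 1 ≤ n)
    (P : Matrix (Fin n → Fin 2) (Fin n → Fin 2) ℂ)
    (hP : P.IsHermitian) (hPproj : P * P = P)
    (σ : ℝ) (hσ0 : 0 < σ) (hσ1 : σ ≤ 1)
    (hdim : P.trace = ((σ * 2^n : ℝ) : ℂ))
    (M : Matrix (Fin n → Fin 2) (Fin n → Fin 2) ℂ)
    (hM0 : M.PosSemidef) (hM1 : (1 - M).PosSemidef)
    (α : ℝ) (hα : 0 ≤ α) (hMtr : ntrace M = σ ^ α)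
    (γ : ℝ) (hγ0 : 0 ≤ γ) (hγ1 : γ < 1)
    (ρ : Matrix (Fin n → Fin 2) (Fin n → Fin 2) ℂ)
    (hρ : ρ = ((σ * 2^n : ℝ) : ℂ)⁻¹ • P) :
    σ ^ ((Real.sqrt α + γ)^2 / (1 - γ^2)) ≤ (M * depolChannel γ ρ).trace.re ∧
      (α = 1 → σ ^ ((1 + γ) / (1 - γ)) ≤ (M * depolChannel γ ρ).trace.re) := by
  have hP0 : P.PosSemidef := by
    have := Matrix.posSemidef_self_mul_conjTranspose P
    rwa [hP.eq, hPproj] at this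
  have hP1 : (1 - P).PosSemidef := by
    have := Matrix.posSemidef_self_mul_conjTranspose (1 - P)
    have e : (1 - P) * (1 - P)ᴴ = 1 - P := by
      simp [Matrix.mul_sub, Matrix.sub_mul, hP.eq, hPproj]
    rwa [e] at this
  have hcard : (Fintype.card (Fin n → Fin 2) : ℝ) = 2 ^ n := by simp
  have hPσ : ntrace P = σ := by
    rw [ntrace, hdim, Complex.ofReal_re, hcard]; field_simp
  have key := rpow_le_ntrace_mul_depolChannel hM0 hM1 hP0 hP1 hσ0 hσ1 (Real.sqrt_nonneg α) hγ0 hγ1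
    (by rw [Real.sq_sqrt hα]; exact hMtr.ge) hPσ.ge
  have hγ2 : 1 - γ ^ 2 ≠ 0 := by nlinarith
  have hT : (M * depolChannel γ ρ).trace.re = σ⁻¹ * ntrace (M * depolChannel γ P) := by
    rw [hρ, depolChannel_smul, Matrix.mul_smul, Matrix.trace_smul, smul_eq_mul,
      ← Complex.ofReal_inv, Complex.re_ofReal_mul, ntrace, hcard, mul_inv]
    ring
  have main : σ ^ ((Real.sqrt α + γ) ^ 2 / (1 - γ ^ 2)) ≤ (M * depolChannel γ ρ).trace.re := by
    rw [hT]
    refine le_trans (le_of_eq ?_) (mul_le_mul_of_nonneg_left key (inv_nonneg.2 hσ0.le))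
    rw [← Real.rpow_neg_one, ← Real.rpow_add hσ0]
    congr 1
    field_simp
    ring
  refine ⟨main, fun h1 => ?_⟩
  have e : (1 + γ) / (1 - γ) = (Real.sqrt α + γ) ^ 2 / (1 - γ ^ 2) := by
    have h3 : 1 - γ ≠ 0 := by linarith
    rw [h1, Real.sqrt_one]
    field_simp
    ring
  rw [e]
  exact main
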